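/- arXiv:2204.03033 — 4 statements merged into one kernel-verified Lean document; each statement's English description precedes it below -/
import Mathlib

section
/- For all positive integers k and n with 1 <= k <= n-1, M(k,n) <= sqrt(2k)·n. -/
/-- The simple transposition `s_i = (i, i+1)` (1-indexed values) in `S_n`,
realized on `Fin n` (0-indexed positions `i-1` and `i`); junk value `1` otherwise. -/
def sgen (n i : ℕ) : Equiv.Perm (Fin n) :=
  if h : 0 < i ∧ i < n then Equiv.swap ⟨i - 1, by omega⟩ ⟨i, h.2⟩ else 1

/-- `l` is a reduced word for `w ∈ S_n`: its product is `w` and it has minimal length. -/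
def IsReducedWordFor (n : ℕ) (l : List ℕ) (w : Equiv.Perm (Fin n)) : Prop :=
  (l.map (sgen n)).prod = w ∧
    ∀ l' : List ℕ, (l'.map (sgen n)).prod = w → l.length ≤ l'.length

/-- The longest permutation `w_0 = n (n-1) ⋯ 2 1` of `S_n`. -/
def longestPerm (n : ℕ) : Equiv.Perm (Fin n) := Fin.revPerm

/-- `M(k,n)`: the maximum multiplicity of `s_k` among reduced words of `w_0 ∈ S_n`. -/
noncomputable def Mmax (k n : ℕ) : ℕ :=
  sSup {N | ∃ l : List ℕ, IsReducedWordFor n l (longestPerm n) ∧ l.count k = N}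

/-- Two finite sets are weakly separated. -/
def WeaklySeparated (I J : Finset ℕ) : Prop :=
  (∀ a ∈ I \ J, ∀ b ∈ J \ I, a < b) ∨ (∀ b ∈ J \ I, ∀ a ∈ I \ J, b < a)

/-- A monotone weakly separated path: pairwise weakly separated, and each step removes
one element `y` and adds one element `x > y`. -/
def IsMWSPath (P : List (Finset ℕ)) : Prop :=
  (∀ A ∈ P, ∀ B ∈ P, WeaklySeparated A B) ∧
    List.Chain' (fun A B => ∃ x y, y ∈ A ∧ x ∉ A ∧ y < x ∧ B = insert x (A.erase y)) P

/-- The inversions of a permutation, recorded as pairs of values. -/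
def valueInversions {n : ℕ} (w : Equiv.Perm (Fin n)) : Finset (Fin n × Fin n) :=
  Finset.univ.filter fun p => p.1 < p.2 ∧ w.symm p.2 < w.symm p.1

/-- The sum of the values of `w` in the first `k` positions. -/
def initialSum {n : ℕ} (k : ℕ) (w : Equiv.Perm (Fin n)) : ℤ :=
  ∑ p : Fin n, (if (p : ℕ) < k then 1 else 0) * ((w p : ℕ) : ℤ)

theorem valueInversions_mul_swap {n : ℕ} (w : Equiv.Perm (Fin n)) {a b : Fin n}
    (hab : (a : ℕ) + 1 = b) (h : w a < w b) :
    valueInversions (w * Equiv.swap a b) = insert (w a, w b) (valueInversions w) ∧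
      (w a, w b) ∉ valueInversions w := by
  constructor
  · ext ⟨x, y⟩
    obtain ⟨p, rfl⟩ := w.surjective x
    obtain ⟨q, rfl⟩ := w.surjective y
    have hs : ∀ z, (w * Equiv.swap a b).symm (w z) = Equiv.swap a b z := fun z => by
      rw [Equiv.symm_apply_eq]; simp
    simp only [valueInversions, Finset.mem_filter, Finset.mem_univ, true_and, Finset.mem_insert,
      Prod.mk.injEq, hs, Equiv.symm_apply_apply, EmbeddingLike.apply_eq_iff_eq]
    rw [Equiv.swap_apply_def, Equiv.swap_apply_def]
    split_ifs <;> subst_vars <;>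
      simp only [Fin.ext_iff, Fin.lt_def, and_self, true_or, iff_true] at * <;> omega
  · simp only [valueInversions, Finset.mem_filter, Equiv.symm_apply_apply, Fin.lt_def]
    omega

theorem initialSum_mul_swap {n k : ℕ} (w : Equiv.Perm (Fin n)) {a b : Fin n}
    (hab : (a : ℕ) + 1 = b) :
    initialSum k (w * Equiv.swap a b) =
      initialSum k w + if (b : ℕ) = k then ((w b : ℕ) : ℤ) - (w a : ℕ) else 0 := by
  have hne : a ≠ b := by rintro rfl; omega
  have h1 : initialSum k (w * Equiv.swap a b) =
      ∑ p : Fin n, (if (Equiv.swap a b p : ℕ) < k then 1 else 0) * ((w p : ℕ) : ℤ) := by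
    rw [← Equiv.sum_comp (Equiv.swap a b)]
    simp [initialSum]
  have h2 : ∀ p : Fin n, (if (Equiv.swap a b p : ℕ) < k then (1 : ℤ) else 0) * ((w p : ℕ) : ℤ) =
      (if (p : ℕ) < k then 1 else 0) * ((w p : ℕ) : ℤ) +
        ((if p = b then if (b : ℕ) = k then ((w b : ℕ) : ℤ) else 0 else 0) -
          if p = a then if (b : ℕ) = k then ((w a : ℕ) : ℤ) else 0 else 0) := by
    intro p
    rw [Equiv.swap_apply_def]
    by_cases hpa : p = a
    · subst hpa
      simp only [if_true, if_neg hne]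
      split_ifs <;> omega
    · by_cases hpb : p = b
      · subst hpb
        simp only [if_true, if_neg hpa]
        split_ifs <;> omega
      · simp [hpa, hpb]
  rw [h1, Finset.sum_congr rfl fun p _ => h2 p, Finset.sum_add_distrib, Finset.sum_sub_distrib]
  simp only [Finset.sum_ite_eq', Finset.mem_univ, if_true, initialSum]
  split_ifs <;> ring

theorem sgen_of_mem {n i : ℕ} (h : 0 < i ∧ i < n) :
    sgen n i = Equiv.swap ⟨i - 1, by omega⟩ ⟨i, h.2⟩ := dif_pos h

theorem sgen_mul_self (n i : ℕ) : sgen n i * sgen n i = 1 := by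
  unfold sgen; split_ifs <;> simp

theorem valueInversions_mul_swap_of_gt {n : ℕ} (w : Equiv.Perm (Fin n)) {a b : Fin n}
    (hab : (a : ℕ) + 1 = b) (h : w b < w a) :
    (valueInversions w).card = (valueInversions (w * Equiv.swap a b)).card + 1 := by
  obtain ⟨h1, h2⟩ := valueInversions_mul_swap (w * Equiv.swap a b) hab (by simpa using h)
  rw [mul_assoc, Equiv.swap_mul_self, mul_one] at h1
  rw [h1, Finset.card_insert_of_notMem h2]

theorem card_valueInversions_mul_sgen_le {n : ℕ} (w : Equiv.Perm (Fin n)) (i : ℕ) :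
    (valueInversions (w * sgen n i)).card ≤ (valueInversions w).card + 1 := by
  by_cases hi : 0 < i ∧ i < n
  · rw [sgen_of_mem hi]
    have hab : ((⟨i - 1, by omega⟩ : Fin n) : ℕ) + 1 = (⟨i, hi.2⟩ : Fin n) := by
      simp only; omega
    rcases lt_trichotomy (w ⟨i - 1, by omega⟩) (w ⟨i, hi.2⟩) with h | h | h
    · rw [(valueInversions_mul_swap w hab h).1]
      exact Finset.card_insert_le _ _
    · have := w.injective h
      simp only [Fin.mk.injEq] at this
      omega
    · have := valueInversions_mul_swap_of_gt w hab h
      omega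
  · simp [sgen, hi]

theorem card_valueInversions_prod_le (n : ℕ) (l : List ℕ) :
    (valueInversions (l.map (sgen n)).prod).card ≤ l.length := by
  induction l using List.reverseRecOn with
  | nil =>
    simp only [List.map_nil, List.prod_nil, List.length_nil, Nat.le_zero, Finset.card_eq_zero]
    refine Finset.filter_false_of_mem fun p _ h => ?_
    exact lt_asymm h.1 h.2
  | append_singleton l i ih =>
    have := card_valueInversions_mul_sgen_le (l.map (sgen n)).prod i
    simp only [List.map_append, List.map_singleton, List.prod_append, List.prod_singleton,
      List.length_append, List.length_singleton]
    omega

theorem exists_descent {n : ℕ} {w : Equiv.Perm (Fin n)} (hw : w ≠ 1) :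
    ∃ (i : ℕ) (hi : 0 < i ∧ i < n), w ⟨i, hi.2⟩ < w ⟨i - 1, by omega⟩ := by
  by_contra! h
  apply hw
  have hmono : StrictMono w := by
    cases n with
    | zero => exact fun a => a.elim0
    | succ n =>
      refine Fin.strictMono_iff_lt_succ.2 fun i => lt_of_le_of_ne ?_ ?_
      · exact h (i + 1) ⟨by omega, by omega⟩
      · exact fun e => i.castSucc_lt_succ.ne (w.injective e)
  ext x
  have : (hmono.orderIsoOfSurjective w w.surjective) = OrderIso.refl _ := Subsingleton.elim _ _
  exact congrArg Fin.val (DFunLike.congr_fun this x)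

theorem exists_word_length_le (n : ℕ) (w : Equiv.Perm (Fin n)) :
    ∃ l : List ℕ, (l.map (sgen n)).prod = w ∧ l.length ≤ (valueInversions w).card := by
  induction hN : (valueInversions w).card generalizing w with
  | zero =>
    by_cases hw : w = 1
    · exact ⟨[], by simp [hw]⟩
    · obtain ⟨i, hi, h⟩ := exists_descent hw
      have := valueInversions_mul_swap_of_gt w (by simp only; omega) h
      omega
  | succ N ih =>
    by_cases hw : w = 1
    · exact ⟨[], by simp [hw]⟩
    · obtain ⟨i, hi, h⟩ := exists_descent hw
      have := valueInversions_mul_swap_of_gt w (by simp only; omega) h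
      rw [← sgen_of_mem hi] at this
      obtain ⟨l, hl, hlen⟩ := ih (w * sgen n i) (by omega)
      refine ⟨l ++ [i], ?_, by simpa using hlen⟩
      simp [hl, mul_assoc, sgen_mul_self]

/-- The occurrences of `s_k` in a reduced word correspond to distinct inversions, whose gaps add up
to the change of the sum of the first `k` values. -/
theorem exists_inversions_of_reduced {n k : ℕ} (l : List ℕ)
    (hl : l.length ≤ (valueInversions (l.map (sgen n)).prod).card) :
    ∃ S ⊆ valueInversions (l.map (sgen n)).prod, S.card = l.count k ∧
      ∑ p ∈ S, (((p.2 : ℕ) : ℤ) - (p.1 : ℕ)) =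
        initialSum k (l.map (sgen n)).prod - initialSum k (1 : Equiv.Perm (Fin n)) := by
  induction l using List.reverseRecOn with
  | nil => exact ⟨∅, by simp⟩
  | append_singleton l i ih =>
    simp only [List.map_append, List.map_singleton, List.prod_append, List.prod_singleton,
      List.length_append, List.length_singleton] at hl ⊢
    have hstep := card_valueInversions_mul_sgen_le (l.map (sgen n)).prod i
    have hle := card_valueInversions_prod_le n l
    obtain ⟨S, hS, hcard, hsum⟩ := ih (by omega)
    generalize (l.map (sgen n)).prod = w at *
    by_cases hi : 0 < i ∧ i < n
    swap
    · simp only [sgen, dif_neg hi, mul_one] at hl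
      omega
    have hab : ((⟨i - 1, by omega⟩ : Fin n) : ℕ) + 1 = (⟨i, hi.2⟩ : Fin n) := by
      simp only; omega
    rw [sgen_of_mem hi] at hl ⊢
    have hasc : w ⟨i - 1, by omega⟩ < w ⟨i, hi.2⟩ := by
      refine lt_of_le_of_ne (not_lt.1 fun h => ?_) fun h => ?_
      · have := valueInversions_mul_swap_of_gt w hab h
        omega
      · have := w.injective h
        simp only [Fin.mk.injEq] at this
        omega
    obtain ⟨hins, hnot⟩ := valueInversions_mul_swap w hab hasc
    rw [hins, initialSum_mul_swap w hab, List.count_append]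
    by_cases hik : i = k
    · refine ⟨insert (w ⟨i - 1, by omega⟩, w ⟨i, hi.2⟩) S, Finset.insert_subset_insert _ hS, ?_, ?_⟩
      · rw [Finset.card_insert_of_notMem fun h => hnot (hS h), hcard]
        simp [hik]
      · rw [Finset.sum_insert fun h => hnot (hS h), hsum, if_pos (by simpa using hik)]
        ring
    · refine ⟨S, hS.trans (Finset.subset_insert _ _), ?_, ?_⟩
      · simp [hcard, hik]
      · rw [hsum, if_neg (by simpa using hik)]
        ring

/-- A finite set of naturals lying above `y` has total distance to `y` at least half the square
of its size. -/
theorem card_sq_le_two_mul_sum_sub (T : Finset ℕ) (y : ℕ) (hT : ∀ x ∈ T, y < x) :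
    (T.card : ℤ) ^ 2 ≤ 2 * ∑ x ∈ T, ((x : ℤ) - y) := by
  induction T using Finset.induction_on_max with
  | empty => simp
  | insert a T ha ih =>
    have hnot : a ∉ T := fun h => lt_irrefl _ (ha a h)
    have hsub : T ⊆ Finset.Ioo y a := fun x hx =>
      Finset.mem_Ioo.2 ⟨hT x (Finset.mem_insert_of_mem hx), ha x hx⟩
    have hcard := Finset.card_le_card hsub
    rw [Nat.card_Ioo] at hcard
    have hya := hT a (Finset.mem_insert_self _ _)
    have := ih fun x hx => hT x (Finset.mem_insert_of_mem hx)
    rw [Finset.sum_insert hnot, Finset.card_insert_of_notMem hnot]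
    have : (T.card : ℤ) + 1 ≤ a - y := by omega
    push_cast
    linarith

theorem card_sq_le_two_mul_sum_gap {n : ℕ} (S : Finset (Fin n × Fin n))
    (hS : ∀ p ∈ S, p.1 < p.2) :
    (S.card : ℤ) ^ 2 ≤ n * (2 * ∑ p ∈ S, (((p.2 : ℕ) : ℤ) - (p.1 : ℕ))) := by
  let fiber (y : Fin n) := S.filter fun p => p.1 = y
  have hfib : ∀ y, ((fiber y).card : ℤ) ^ 2 ≤
      2 * ∑ p ∈ fiber y, (((p.2 : ℕ) : ℤ) - (p.1 : ℕ)) := by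
    intro y
    have hinj : Set.InjOn (fun p : Fin n × Fin n => (p.2 : ℕ)) (fiber y) := by
      intro p hp q hq h
      simp only [fiber, Finset.coe_filter, Set.mem_ofPred_eq] at hp hq
      exact Prod.ext (hp.2.trans hq.2.symm) (Fin.ext h)
    have := card_sq_le_two_mul_sum_sub ((fiber y).image fun p => (p.2 : ℕ)) y (by
      simp only [Finset.mem_image, fiber, Finset.mem_filter]
      rintro _ ⟨p, ⟨hp, rfl⟩, rfl⟩
      exact hS p hp)
    rw [Finset.card_image_of_injOn hinj, Finset.sum_image hinj] at this
    refine this.trans_eq (congrArg _ (Finset.sum_congr rfl fun p hp => ?_))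
    rw [(Finset.mem_filter.1 hp).2]
  have hcard : (S.card : ℤ) = ∑ y, ((fiber y).card : ℤ) := by
    exact_mod_cast Finset.card_eq_sum_card_fiberwise (s := S) (t := Finset.univ) (f := Prod.fst)
      fun _ _ => Finset.mem_coe.2 (Finset.mem_univ _)
  calc (S.card : ℤ) ^ 2 = (∑ y, ((fiber y).card : ℤ)) ^ 2 := by rw [hcard]
    _ ≤ n * ∑ y, ((fiber y).card : ℤ) ^ 2 := by
      simpa using sq_sum_le_card_mul_sum_sq (s := Finset.univ) (f := fun y => ((fiber y).card : ℤ))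
    _ ≤ n * ∑ y, 2 * ∑ p ∈ fiber y, (((p.2 : ℕ) : ℤ) - (p.1 : ℕ)) := by
      gcongr with y
      exact hfib y
    _ = n * (2 * ∑ p ∈ S, (((p.2 : ℕ) : ℤ) - (p.1 : ℕ))) := by
      rw [← Finset.mul_sum, Finset.sum_fiberwise]

theorem initialSum_nonneg {n : ℕ} (k : ℕ) (w : Equiv.Perm (Fin n)) : 0 ≤ initialSum k w :=
  Finset.sum_nonneg fun p _ => by positivity

theorem initialSum_le {n k : ℕ} (hkn : k ≤ n) (w : Equiv.Perm (Fin n)) :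
    initialSum k w ≤ k * n := by
  calc initialSum k w ≤ ∑ p : Fin n, (if (p : ℕ) < k then 1 else 0) * (n : ℤ) :=
        Finset.sum_le_sum fun p _ =>
          mul_le_mul_of_nonneg_left (by exact_mod_cast (w p).is_lt.le) (by positivity)
    _ = k * n := by
      rw [← Finset.sum_mul, Fin.sum_univ_eq_sum_range fun p => if p < k then (1 : ℤ) else 0,
        ← Finset.sum_filter]
      have : (Finset.range n).filter (· < k) = Finset.range k := by
        ext p; simp only [Finset.mem_filter, Finset.mem_range]; omega
      simp [this]

theorem count_sq_le_of_isReducedWordFor {n k : ℕ} (hkn : k ≤ n) {l : List ℕ}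
    {w : Equiv.Perm (Fin n)} (hl : IsReducedWordFor n l w) :
    (l.count k) ^ 2 ≤ 2 * k * n ^ 2 := by
  obtain ⟨l', hl', hlen⟩ := exists_word_length_le n w
  obtain ⟨rfl, hmin⟩ := hl
  obtain ⟨S, hS, hcard, hsum⟩ := exists_inversions_of_reduced (k := k) l ((hmin l' hl').trans hlen)
  have h1 := card_sq_le_two_mul_sum_gap S fun p hp => (Finset.mem_filter.1 (hS hp)).2.1
  rw [hsum, hcard] at h1
  have h2 := initialSum_le hkn (l.map (sgen n)).prod
  have h3 := initialSum_nonneg k (1 : Equiv.Perm (Fin n))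
  have h4 : ((l.count k : ℕ) : ℤ) ^ 2 ≤ n * (2 * (k * n)) := h1.trans (by gcongr; linarith)
  zify
  linarith

theorem stmt6 (k n : ℕ) (hk : 1 ≤ k) (hkn : k ≤ n - 1) :
    (Mmax k n : ℝ) ≤ Real.sqrt (2 * k) * n := by
  rw [← Nat.le_floor_iff (by positivity)]
  refine csSup_le' ?_
  rintro _ ⟨l, hl, rfl⟩
  have h := count_sq_le_of_isReducedWordFor (k := k) (by omega) hl
  refine Nat.le_floor (abs_le_of_sq_le_sq' ?_ (by positivity)).2
  rw [mul_pow, Real.sq_sqrt (by positivity)]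
  exact_mod_cast h
end

section
/- For every integer n >= 4, M(3,n) = ceil(11n/6) - 5. -/
/-- The sequence `A` of 3-element sets changes only by exchanging an element for a larger one;
`c t` counts the exchanges from time `t` on. If `i < j` and `j` has been present without `i`,
then `i` is never present without `j` afterwards. -/
structure SepPath (A : ℕ → Finset ℕ) (c : ℕ → ℕ) : Prop where
  card : ∀ t, (A t).card = 3
  step : ∀ t, (A (t + 1) = A t ∧ c t = c (t + 1)) ∨
    ∃ y x, y ∈ A t ∧ x ∉ A t ∧ y < x ∧ A (t + 1) = insert x ((A t).erase y) ∧ c t = c (t + 1) + 1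
  sep : ∀ s t i j, s ≤ t → i < j → j ∈ A s → i ∉ A s → i ∈ A t → j ∈ A t

namespace SepPath

variable {A : ℕ → Finset ℕ} {c : ℕ → ℕ} {t : ℕ}

/-- The elements present at some time up to `t`. -/
def seen (A : ℕ → Finset ℕ) (t : ℕ) : Finset ℕ := (Finset.range (t + 1)).biUnion A

/-- `v` has been present, is absent at time `t`, and will be present again. -/
def Pending (A : ℕ → Finset ℕ) (t v : ℕ) : Prop :=
  v ∈ seen A t ∧ v ∉ A t ∧ ∃ s, t ≤ s ∧ v ∈ A s

/-- `j` has been present without `i` up to time `t`. -/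
def Crossed (A : ℕ → Finset ℕ) (t i j : ℕ) : Prop := ∃ s, s ≤ t ∧ j ∈ A s ∧ i ∉ A s

/-- The number of elements of `A t` smaller than `v`. -/
def below (A : ℕ → Finset ℕ) (t v : ℕ) : ℕ := ∑ u ∈ A t, if u < v then 1 else 0

lemma mem_seen {v : ℕ} : v ∈ seen A t ↔ ∃ s, s ≤ t ∧ v ∈ A s := by
  simp [seen]

lemma seen_succ : seen A (t + 1) = seen A t ∪ A (t + 1) := by
  rw [seen, Finset.range_add_one, Finset.biUnion_insert, Finset.union_comm, seen]

lemma subset_seen : A t ⊆ seen A t := fun _ hv => mem_seen.2 ⟨t, le_rfl, hv⟩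

lemma Crossed.succ {i j : ℕ} (h : Crossed A t i j) : Crossed A (t + 1) i j := by
  obtain ⟨s, hs, h⟩ := h
  exact ⟨s, by omega, h⟩

lemma below_succ (v : ℕ) : below A t (v + 1) = below A t v + if v ∈ A t then 1 else 0 := by
  have : ∀ u, (if u < v + 1 then 1 else 0) = (if u < v then 1 else 0) + if u = v then 1 else 0 := by
    intro u; split_ifs <;> omega
  simp only [below, this, Finset.sum_add_distrib, Finset.sum_ite_eq']

lemma below_triple {a b d : ℕ} (h : A t = {a, b, d}) (hab : a ≠ b) (had : a ≠ d) (hbd : b ≠ d)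
    (v : ℕ) : below A t v =
      (if a < v then 1 else 0) + ((if b < v then 1 else 0) + if d < v then 1 else 0) := by
  rw [below, h, Finset.sum_insert (by simp [hab, had]), Finset.sum_pair hbd]

lemma antitone_below (hP : SepPath A c) (v : ℕ) : Antitone fun t => below A t v := by
  refine antitone_nat_of_succ_le fun t => ?_
  rcases hP.step t with ⟨h, -⟩ | ⟨y, x, hy, hx, hyx, h, -⟩
  · simp [below, h]
  · have h1 := Finset.add_sum_erase (A t) (fun u => if u < v then 1 else 0) hy
    simp only [below, h] at h1 ⊢
    rw [Finset.sum_insert (by simp [hx])]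
    split_ifs at h1 ⊢ <;> omega

lemma below_lt_of_return (hP : SepPath A c) {s v : ℕ} (hts : t ≤ s) (ht : v ∉ A t) (hs : v ∈ A s) :
    below A s v < below A t v := by
  have h := hP.antitone_below (v + 1) hts
  simp only [below_succ, ht, hs, if_true, if_false] at h
  omega

lemma mem_of_below_eq (hP : SepPath A c) {r s v : ℕ} (htr : t ≤ r) (hrs : r ≤ s)
    (hs : v ∈ A s) (h : below A t v = below A s v) : v ∈ A r := by
  by_contra hr
  have h1 := hP.below_lt_of_return hrs hr hs
  have h2 := hP.antitone_below v htr
  simp only at h2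
  omega

lemma eq_triple (hP : SepPath A c) {a b d : ℕ} (ha : a ∈ A t) (hb : b ∈ A t) (hd : d ∈ A t)
    (hab : a ≠ b) (had : a ≠ d) (hbd : b ≠ d) : A t = {a, b, d} := by
  symm
  apply Finset.eq_of_subset_of_card_le
  · simp [Finset.insert_subset_iff, ha, hb, hd]
  · rw [hP.card, Finset.card_insert_of_notMem (by simp [hab, had]), Finset.card_pair hbd]

lemma exists_sorted (hP : SepPath A c) (t : ℕ) :
    ∃ a b d, a < b ∧ b < d ∧ A t = {a, b, d} := by
  obtain ⟨x, y, z, hxy, hxz, hyz, h⟩ := Finset.card_eq_three.1 (hP.card t)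
  have hx : x ∈ A t := by simp [h]
  have hy : y ∈ A t := by simp [h]
  have hz : z ∈ A t := by simp [h]
  have key : ∀ a b d, a ∈ A t → b ∈ A t → d ∈ A t → a < b → b < d →
      ∃ a b d, a < b ∧ b < d ∧ A t = {a, b, d} := fun a b d ha hb hd hab hbd =>
    ⟨a, b, d, hab, hbd, hP.eq_triple ha hb hd (by omega) (by omega) (by omega)⟩
  rcases lt_or_gt_of_ne hxy with h1 | h1 <;> rcases lt_or_gt_of_ne hxz with h2 | h2 <;>
    rcases lt_or_gt_of_ne hyz with h3 | h3
  · exact key x y z hx hy hz h1 h3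
  · exact key x z y hx hz hy h2 h3
  · omega
  · exact key z x y hz hx hy h2 h1
  · exact key y x z hy hx hz h1 h2
  · omega
  · exact key y z x hy hz hx h3 h2
  · exact key z y x hz hy hx h3 h1

/-- `Potential A t v` bounds by `v` the excess of six times the number of remaining exchanges over
eleven times the number of elements not yet seen; it is read off from the pending elements and
from the crossings among the present ones. -/
inductive Potential (A : ℕ → Finset ℕ) (t : ℕ) : ℤ → Prop
  | free : (∀ v, ¬ Pending A t v) → Potential A t 8
  | free₁₂ {a b d : ℕ} : (∀ v, ¬ Pending A t v) → A t = {a, b, d} → a < b → b < d →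
      Crossed A t a b → Potential A t 5
  | free₁₂₁₃ {a b d : ℕ} : (∀ v, ¬ Pending A t v) → A t = {a, b, d} → a < b → a < d →
      b ≠ d → Crossed A t a b → Crossed A t a d → Potential A t 3
  | free₂₃ {a b d : ℕ} : (∀ v, ¬ Pending A t v) → A t = {a, b, d} → a < b → b < d →
      Crossed A t b d → Potential A t 4
  | freeAll {a b d : ℕ} : (∀ v, ¬ Pending A t v) → A t = {a, b, d} → a < b → b < d →
      Crossed A t a b → Crossed A t a d → Crossed A t b d → Potential A t 0
  | second {a d e q : ℕ} : (∀ v, Pending A t v ↔ v = q) → A t = {a, d, e} → a < q → q < d →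
      q < e → d ≠ e → Potential A t 9
  | second' {a d e q : ℕ} : (∀ v, Pending A t v ↔ v = q) → A t = {a, d, e} → a < q → q < d →
      d < e → Crossed A t d e → Potential A t 6
  | third {a b d q : ℕ} : (∀ v, Pending A t v ↔ v = q) → A t = {a, b, d} → a < b → b < q →
      q < d → Potential A t 13
  | third' {a b d q : ℕ} : (∀ v, Pending A t v ↔ v = q) → A t = {a, b, d} → a < b → b < q →
      q < d → Crossed A t a b → Potential A t 10
  | seconds {a d e q r : ℕ} : (∀ v, Pending A t v ↔ v = q ∨ v = r) → A t = {a, d, e} → a < q →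
      q < r → r < d → r < e → d ≠ e → Potential A t 15
  | seconds' {a d e q r : ℕ} : (∀ v, Pending A t v ↔ v = q ∨ v = r) → A t = {a, d, e} → a < q →
      q < r → r < d → d < e → Crossed A t d e → Potential A t 12
  | thirds {a b d q r : ℕ} : (∀ v, Pending A t v ↔ v = q ∨ v = r) → A t = {a, b, d} → a < b →
      b < q → q < r → r < d → Crossed A t q r → Potential A t 18
  | thirds' {a b d q r : ℕ} : (∀ v, Pending A t v ↔ v = q ∨ v = r) → A t = {a, b, d} → a < b →
      b < q → q < r → r < d → Crossed A t q r → Crossed A t a b → Potential A t 15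

/-- An exchange at time `t` of `y` for `x`. -/
structure Exchange (A : ℕ → Finset ℕ) (t y x : ℕ) : Prop where
  mem : y ∈ A t
  notMem : x ∉ A t
  lt : y < x
  eq : A (t + 1) = insert x ((A t).erase y)

namespace Exchange

variable {y x : ℕ}

lemma mem_succ (h : Exchange A t y x) {v : ℕ} : v ∈ A (t + 1) ↔ v = x ∨ v ≠ y ∧ v ∈ A t := by
  simp [h.eq]

lemma mem_or (h : Exchange A t y x) : x ∉ seen A t ∨ Pending A t x := by
  by_cases hx : x ∈ seen A t
  · exact .inr ⟨hx, h.notMem, t + 1, by omega, by simp [h.mem_succ]⟩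
  · exact .inl hx

lemma pending_succ (h : Exchange A t y x) (v : ℕ) :
    Pending A (t + 1) v ↔ (Pending A t v ∧ v ≠ x) ∨ (v = y ∧ Pending A (t + 1) y) := by
  by_cases hvy : v = y
  · subst hvy
    simp [Pending, h.mem]
  · simp only [Pending, seen_succ, Finset.mem_union, h.mem_succ, hvy, false_and, or_false]
    constructor
    · rintro ⟨h1, h2, s, hs, hv⟩
      refine ⟨⟨?_, ?_, s, by omega, hv⟩, ?_⟩ <;> grind
    · rintro ⟨⟨h1, h2, s, hs, hv⟩, hx⟩
      refine ⟨.inl h1, by grind, s, ?_, hv⟩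
      rcases hs.lt_or_eq with h3 | rfl
      · omega
      · exact absurd hv h2

lemma lt_of_notMem_seen (h : Exchange A t y x) (hP : SepPath A c) (hx : x ∉ seen A t) {q : ℕ}
    (hq : Pending A t q) : q < x := by
  obtain ⟨h1, h2, -⟩ := hq
  by_contra hlt
  have hne : q ≠ x := fun h => hx (h ▸ h1)
  obtain ⟨s, hs, hqs⟩ := mem_seen.1 h1
  have := hP.sep s (t + 1) x q (by omega) (by omega) hqs
    (fun hxs => hx (mem_seen.2 ⟨s, hs, hxs⟩)) (by simp [h.mem_succ])
  rw [h.mem_succ] at this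
  tauto

lemma sep_succ (h : Exchange A t y x) (hP : SepPath A c) {i j : ℕ} (hc : Crossed A t i j)
    (hij : i < j) (hi : i ≠ y) (hit : i ∈ A t) (hj : j ∈ A t) : j ≠ y := by
  rintro rfl
  obtain ⟨s, hs, hjs, his⟩ := hc
  have := hP.sep s (t + 1) i j (by omega) hij hjs his (by simp [h.mem_succ, hi, hit])
  rw [h.mem_succ] at this
  rcases this with rfl | h1
  · exact h.notMem hj
  · exact h1.1 rfl

end Exchange

lemma Crossed.of_mem {i j : ℕ} (hj : j ∈ A t) (hi : i ∉ A t) : Crossed A t i j :=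
  ⟨t, le_rfl, hj, hi⟩

lemma Pending.exists_later {q : ℕ} (h : Pending A t q) : ∃ s, t + 1 ≤ s ∧ q ∈ A s := by
  obtain ⟨-, hq, s, hs, hqs⟩ := h
  refine ⟨s, ?_, hqs⟩
  rcases hs.lt_or_eq with h | rfl
  · exact h
  · exact absurd hqs hq

lemma exists_lt_of_pending (hP : SepPath A c) {y : ℕ} (hy : Pending A (t + 1) y) :
    ∃ z ∈ A t, z < y := by
  obtain ⟨-, hy1, s, hs, hys⟩ := hy
  by_contra! hz
  have h0 : below A t y = 0 := Finset.sum_eq_zero fun u hu => if_neg (by have := hz u hu; omega)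
  have h1 := hP.below_lt_of_return hs hy1 hys
  have h2 := hP.antitone_below y (Nat.le_add_right t 1)
  simp only at h2
  omega

lemma not_pending_min {a b d : ℕ} (hP : SepPath A c) (hA : A t = {a, b, d}) (hab : a < b)
    (had : a < d) : ¬ Pending A (t + 1) a := by
  intro hp
  obtain ⟨z, hz, hlt⟩ := hP.exists_lt_of_pending hp
  rw [hA] at hz
  simp only [Finset.mem_insert, Finset.mem_singleton] at hz
  omega

namespace Exchange

variable {y x : ℕ}

lemma succ_eq₁ {a b d : ℕ} (h : Exchange A t a x) (hA : A t = {a, b, d}) (hab : a ≠ b)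
    (had : a ≠ d) : A (t + 1) = {x, b, d} := by
  ext v; rw [h.mem_succ, hA]; grind

lemma succ_eq₂ {a b d : ℕ} (h : Exchange A t b x) (hA : A t = {a, b, d}) (hab : a ≠ b)
    (hbd : b ≠ d) : A (t + 1) = {a, x, d} := by
  ext v; rw [h.mem_succ, hA]; grind

lemma succ_eq₃ {a b d : ℕ} (h : Exchange A t d x) (hA : A t = {a, b, d}) (had : a ≠ d)
    (hbd : b ≠ d) : A (t + 1) = {a, b, x} := by
  ext v; rw [h.mem_succ, hA]; grind

lemma cases_triple {a b d : ℕ} (h : Exchange A t y x) (hA : A t = {a, b, d}) :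
    y = a ∨ y = b ∨ y = d := by
  have := h.mem
  rw [hA] at this
  simpa using this

lemma free_of_free (h : Exchange A t y x) (hf : ∀ v, ¬ Pending A t v)
    (hy : ¬ Pending A (t + 1) y) : Potential A (t + 1) 8 :=
  .free fun v => by rw [h.pending_succ]; simp [hf, hy]

lemma pending_iff_of_free (h : Exchange A t y x) (hf : ∀ v, ¬ Pending A t v)
    (hy : Pending A (t + 1) y) (v : ℕ) : Pending A (t + 1) v ↔ v = y := by
  rw [h.pending_succ]; simp [hf, hy]

lemma second_of_free {a b d : ℕ} (h : Exchange A t b x) (hf : ∀ v, ¬ Pending A t v)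
    (hy : Pending A (t + 1) b) (hA : A t = {a, b, d}) (hab : a < b) (hbd : b < d) :
    Potential A (t + 1) 9 := by
  have hxd : x ≠ d := by rintro rfl; exact h.notMem (by simp [hA])
  exact .second (h.pending_iff_of_free hf hy) (h.succ_eq₂ hA hab.ne hbd.ne) hab h.lt hbd hxd

lemma third_of_free {a b d : ℕ} (h : Exchange A t d x) (hf : ∀ v, ¬ Pending A t v)
    (hy : Pending A (t + 1) d) (hA : A t = {a, b, d}) (hab : a < b) (hbd : b < d) :
    Potential A (t + 1) 13 :=
  .third (h.pending_iff_of_free hf hy) (h.succ_eq₃ hA (by omega) (by omega)) hab hbd h.lt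

lemma eq_min_of_second {a d e q : ℕ} (h : Exchange A t y x) (hP : SepPath A c)
    (hq : Pending A t q) (hA : A t = {a, d, e}) (haq : a < q) (hqd : q < d) (hqe : q < e)
    (hde : d ≠ e) : y = a ∧ x ≤ q := by
  obtain ⟨s, hs, hqs⟩ := hq.exists_later
  have hd : d ∈ A t := by simp [hA]
  have he : e ∈ A t := by simp [hA]
  have hds : d ∈ A s := hP.sep t s q d (by omega) hqd hd hq.2.1 hqs
  have hes : e ∈ A s := hP.sep t s q e (by omega) hqe he hq.2.1 hqs
  have hAs : A s = {q, d, e} := hP.eq_triple hqs hds hes hqd.ne hqe.ne hde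
  have bt := below_triple hA (by omega) (by omega) hde
  have bs := below_triple hAs (by omega) (by omega) hde
  have hd1 : d ∈ A (t + 1) := hP.mem_of_below_eq (Nat.le_add_right t 1) hs hds (by
    rw [bt, bs]; split_ifs <;> omega)
  have he1 : e ∈ A (t + 1) := hP.mem_of_below_eq (Nat.le_add_right t 1) hs hes (by
    rw [bt, bs]; split_ifs <;> omega)
  rw [h.mem_succ] at hd1 he1
  have hx := h.notMem
  refine ⟨by have := h.cases_triple hA; grind, ?_⟩
  by_contra! hlt
  have hxs : x ∈ A s := hP.sep (t + 1) s q x hs hlt (by simp [h.mem_succ])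
    (by rw [h.mem_succ]; have := hq.2.1; grind) hqs
  grind

lemma eq_of_thirds {a b d q r : ℕ} (h : Exchange A t y x) (hP : SepPath A c)
    (hp : ∀ v, Pending A t v ↔ v = q ∨ v = r) (hA : A t = {a, b, d}) (hab : a < b)
    (hbq : b < q) (hqr : q < r) (hrd : r < d) (hc : Crossed A t q r) :
    Pending A t x ∧ x = r ∧ (y = a ∨ y = b) := by
  have hq := (hp q).2 (.inl rfl)
  have hr := (hp r).2 (.inr rfl)
  obtain ⟨s, hs, hqs⟩ := hq.exists_later
  have hd : d ∈ A t := by simp [hA]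
  have hds : d ∈ A s := hP.sep t s q d (by omega) (by omega) hd hq.2.1 hqs
  obtain ⟨s', hs', hrs', hqs'⟩ := hc
  have hrs : r ∈ A s := hP.sep s' s q r (by omega) hqr hrs' hqs' hqs
  have hAs : A s = {q, r, d} := hP.eq_triple hqs hrs hds (by omega) (by omega) (by omega)
  have hd1 : d ∈ A (t + 1) := hP.mem_of_below_eq (Nat.le_add_right t 1) hs hds (by
    rw [below_triple hA (by omega) (by omega) (by omega),
      below_triple hAs (by omega) (by omega) (by omega)]
    split_ifs <;> omega)
  have hx1 : x ∈ A (t + 1) := by simp [h.mem_succ]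
  have hxq : x ≠ q := by
    rintro rfl
    have := hP.sep s' (t + 1) x r (by omega) hqr hrs' hqs' hx1
    rw [h.mem_succ] at this
    have := hr.2.1
    grind
  have hq1 : q ∉ A (t + 1) := by rw [h.mem_succ]; have := hq.2.1; grind
  have hy := h.cases_triple hA
  have hxt := h.notMem
  rw [h.mem_succ] at hd1
  have hxr : Pending A t x := by
    refine h.mem_or.resolve_left fun hx => ?_
    have hrx := h.lt_of_notMem_seen hP hx hr
    have hxs := hP.sep (t + 1) s q x hs (by omega) hx1 hq1 hqs
    grind
  exact ⟨hxr, by have := (hp x).1 hxr; tauto, by grind⟩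

end Exchange

/-- The changes of potential allowed by an exchange bringing in `x`. -/
def Progress (A : ℕ → Finset ℕ) (t x : ℕ) (v : ℤ) : Prop :=
  (x ∉ seen A t ∧ ∃ w, Potential A (t + 1) w ∧ w ≤ v + 5) ∨
    (x ∈ seen A t ∧ ∃ w, Potential A (t + 1) w ∧ w + 6 ≤ v)

variable {x y : ℕ}

lemma progress_of_free (h : Exchange A t y x) (hf : ∀ v, ¬ Pending A t v)
    {v w : ℤ} (hw : Potential A (t + 1) w) (hwv : w ≤ v + 5) : Progress A t x v :=
  .inl ⟨h.mem_or.resolve_right (hf x), w, hw, hwv⟩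

lemma progress_free (hP : SepPath A c) (h : Exchange A t y x) (hf : ∀ v, ¬ Pending A t v) :
    Progress A t x 8 := by
  by_cases hy : Pending A (t + 1) y
  · obtain ⟨a, b, d, hab, hbd, hA⟩ := hP.exists_sorted t
    rcases h.cases_triple hA with rfl | rfl | rfl
    · exact absurd hy (hP.not_pending_min hA hab (hab.trans hbd))
    · exact progress_of_free h hf (h.second_of_free hf hy hA hab hbd) (by norm_num)
    · exact progress_of_free h hf (h.third_of_free hf hy hA hab hbd) (by norm_num)
  · exact progress_of_free h hf (h.free_of_free hf hy) (by norm_num)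

lemma progress_free₁₂ (hP : SepPath A c) (h : Exchange A t y x) (hf : ∀ v, ¬ Pending A t v)
    {a b d : ℕ} (hA : A t = {a, b, d}) (hab : a < b) (hbd : b < d) (hc : Crossed A t a b) :
    Progress A t x 5 := by
  by_cases hy : Pending A (t + 1) y
  · rcases h.cases_triple hA with rfl | rfl | rfl
    · exact absurd hy (hP.not_pending_min hA hab (hab.trans hbd))
    · exact absurd rfl (h.sep_succ hP hc hab hab.ne (by simp [hA]) (by simp [hA]))
    · exact progress_of_free h hf (.third' (h.pending_iff_of_free hf hy)
        (h.succ_eq₃ hA (by omega) (by omega)) hab hbd h.lt hc.succ) (by norm_num)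
  · exact progress_of_free h hf (h.free_of_free hf hy) (by norm_num)

lemma progress_free₁₂₁₃ (hP : SepPath A c) (h : Exchange A t y x) (hf : ∀ v, ¬ Pending A t v)
    {a b d : ℕ} (hA : A t = {a, b, d}) (hab : a < b) (had : a < d) (hc : Crossed A t a b)
    (hc' : Crossed A t a d) : Progress A t x 3 := by
  by_cases hy : Pending A (t + 1) y
  · rcases h.cases_triple hA with rfl | rfl | rfl
    · exact absurd hy (hP.not_pending_min hA hab had)
    · exact absurd rfl (h.sep_succ hP hc hab hab.ne (by simp [hA]) (by simp [hA]))
    · exact absurd rfl (h.sep_succ hP hc' had had.ne (by simp [hA]) (by simp [hA]))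
  · exact progress_of_free h hf (h.free_of_free hf hy) (by norm_num)

lemma progress_free₂₃ (hP : SepPath A c) (h : Exchange A t y x) (hf : ∀ v, ¬ Pending A t v)
    {a b d : ℕ} (hA : A t = {a, b, d}) (hab : a < b) (hbd : b < d) (hc : Crossed A t b d) :
    Progress A t x 4 := by
  by_cases hy : Pending A (t + 1) y
  · rcases h.cases_triple hA with rfl | rfl | rfl
    · exact absurd hy (hP.not_pending_min hA hab (hab.trans hbd))
    · exact progress_of_free h hf (h.second_of_free hf hy hA hab hbd) (by norm_num)
    · exact absurd rfl (h.sep_succ hP hc hbd hbd.ne (by simp [hA]) (by simp [hA]))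
  · exact progress_of_free h hf (h.free_of_free hf hy) (by norm_num)

lemma progress_freeAll (hP : SepPath A c) (h : Exchange A t y x) (hf : ∀ v, ¬ Pending A t v)
    {a b d : ℕ} (hA : A t = {a, b, d}) (hab : a < b) (hbd : b < d) (hc₁₂ : Crossed A t a b)
    (hc₁₃ : Crossed A t a d) (hc₂₃ : Crossed A t b d) : Progress A t x 0 := by
  have hb : b ∈ A t := by simp [hA]
  have hd : d ∈ A t := by simp [hA]
  have hy : y = a := by
    rcases h.cases_triple hA with rfl | rfl | rfl
    · rfl
    · exact absurd rfl (h.sep_succ hP hc₁₂ hab hab.ne (by simp [hA]) hb)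
    · exact absurd rfl (h.sep_succ hP hc₂₃ hbd hbd.ne hb hd)
  subst hy
  have hf' : ∀ v, ¬ Pending A (t + 1) v := fun v => by
    rw [h.pending_succ]
    simp [hf, hP.not_pending_min hA hab (hab.trans hbd)]
  have hA' := h.succ_eq₁ hA hab.ne (hab.trans hbd).ne
  have hxt := h.notMem
  have hxb : Crossed A (t + 1) x b := (Crossed.of_mem hb hxt).succ
  have hxd : Crossed A (t + 1) x d := (Crossed.of_mem hd hxt).succ
  rcases lt_trichotomy x b with hlt | rfl | hlt
  · exact progress_of_free h hf (.freeAll hf' hA' hlt hbd hxb hxd hc₂₃.succ) (by norm_num)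
  · exact absurd hb hxt
  rcases lt_trichotomy x d with hlt' | rfl | hlt'
  · exact progress_of_free h hf
      (.free₂₃ hf' (by rw [hA']; grind) hlt hlt' hxd) (by norm_num)
  · exact absurd hd hxt
  · exact progress_of_free h hf
      (.free₁₂ hf' (by rw [hA']; grind) hbd hlt' hc₂₃.succ) (by norm_num)

lemma eq_of_second (hP : SepPath A c) (h : Exchange A t y x) {a d e q : ℕ}
    (hp : ∀ v, Pending A t v ↔ v = q) (hA : A t = {a, d, e}) (haq : a < q) (hqd : q < d)
    (hqe : q < e) (hde : d ≠ e) :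
    y = a ∧ x = q ∧ x ∈ seen A t ∧ ∀ v, ¬ Pending A (t + 1) v := by
  have hq := (hp q).2 rfl
  obtain ⟨rfl, hxq⟩ := h.eq_min_of_second hP hq hA haq hqd hqe hde
  have hx : Pending A t x := h.mem_or.resolve_left fun hx => by
    have := h.lt_of_notMem_seen hP hx hq; omega
  refine ⟨rfl, (hp x).1 hx, hx.1, fun v => ?_⟩
  rw [h.pending_succ, hp, (hp x).1 hx]
  simp [hP.not_pending_min hA (haq.trans hqd) (haq.trans hqe)]

lemma progress_second (hP : SepPath A c) (h : Exchange A t y x) {a d e q : ℕ}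
    (hp : ∀ v, Pending A t v ↔ v = q) (hA : A t = {a, d, e}) (haq : a < q) (hqd : q < d)
    (hqe : q < e) (hde : d ≠ e) : Progress A t x 9 := by
  obtain ⟨rfl, rfl, hx, hf⟩ := eq_of_second hP h hp hA haq hqd hqe hde
  exact .inr ⟨hx, 3, .free₁₂₁₃ hf (h.succ_eq₁ hA (by omega) (by omega)) hqd hqe hde
    (Crossed.of_mem (by simp [hA]) h.notMem).succ (Crossed.of_mem (by simp [hA]) h.notMem).succ,
    by norm_num⟩

lemma progress_second' (hP : SepPath A c) (h : Exchange A t y x) {a d e q : ℕ}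
    (hp : ∀ v, Pending A t v ↔ v = q) (hA : A t = {a, d, e}) (haq : a < q) (hqd : q < d)
    (hde : d < e) (hc : Crossed A t d e) : Progress A t x 6 := by
  obtain ⟨rfl, rfl, hx, hf⟩ := eq_of_second hP h hp hA haq hqd (hqd.trans hde) hde.ne
  exact .inr ⟨hx, 0, .freeAll hf (h.succ_eq₁ hA (by omega) (by omega)) hqd hde
    (Crossed.of_mem (by simp [hA]) h.notMem).succ (Crossed.of_mem (by simp [hA]) h.notMem).succ
    hc.succ, by norm_num⟩

lemma eq_of_seconds (hP : SepPath A c) (h : Exchange A t y x) {a d e q r : ℕ}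
    (hp : ∀ v, Pending A t v ↔ v = q ∨ v = r) (hA : A t = {a, d, e}) (haq : a < q) (hqr : q < r)
    (hrd : r < d) (hre : r < e) (hde : d ≠ e) :
    y = a ∧ x = q ∧ x ∈ seen A t ∧ ∀ v, Pending A (t + 1) v ↔ v = r := by
  have hq := (hp q).2 (.inl rfl)
  obtain ⟨rfl, hxq⟩ := h.eq_min_of_second hP hq hA haq (hqr.trans hrd) (hqr.trans hre) hde
  have hx : Pending A t x := h.mem_or.resolve_left fun hx => by
    have := h.lt_of_notMem_seen hP hx hq; omega
  have hxeq : x = q := by have := (hp x).1 hx; omega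
  refine ⟨rfl, hxeq, hx.1, fun v => ?_⟩
  rw [h.pending_succ, hp, hxeq]
  simp only [hP.not_pending_min hA (by omega) (by omega)]
  have := hqr.ne
  grind

lemma progress_seconds (hP : SepPath A c) (h : Exchange A t y x) {a d e q r : ℕ}
    (hp : ∀ v, Pending A t v ↔ v = q ∨ v = r) (hA : A t = {a, d, e}) (haq : a < q) (hqr : q < r)
    (hrd : r < d) (hre : r < e) (hde : d ≠ e) : Progress A t x 15 := by
  obtain ⟨rfl, rfl, hx, hf⟩ := eq_of_seconds hP h hp hA haq hqr hrd hre hde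
  exact .inr ⟨hx, 9, .second hf (h.succ_eq₁ hA (by omega) (by omega)) hqr hrd hre hde,
    by norm_num⟩

lemma progress_seconds' (hP : SepPath A c) (h : Exchange A t y x) {a d e q r : ℕ}
    (hp : ∀ v, Pending A t v ↔ v = q ∨ v = r) (hA : A t = {a, d, e}) (haq : a < q) (hqr : q < r)
    (hrd : r < d) (hde : d < e) (hc : Crossed A t d e) : Progress A t x 12 := by
  obtain ⟨rfl, rfl, hx, hf⟩ := eq_of_seconds hP h hp hA haq hqr hrd (hrd.trans hde) hde.ne
  exact .inr ⟨hx, 6, .second' hf (h.succ_eq₁ hA (by omega) (by omega)) hqr hrd hde hc.succ,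
    by norm_num⟩

lemma progress_third_of_pending (hP : SepPath A c) {a b d q : ℕ} (h : Exchange A t y x)
    (hp : ∀ v, Pending A t v ↔ v = q) (hA : A t = {a, b, d}) (hab : a < b) (hbq : b < q)
    (hqd : q < d) (hx : x ∈ seen A t) {v : ℤ} (hv : 10 ≤ v)
    (hv' : y = b → 12 ≤ v) : Progress A t x v := by
  have hxq : x = q := (hp x).1 (h.mem_or.resolve_left (not_not.2 hx))
  subst hxq
  have hc : Crossed A (t + 1) x d := (Crossed.of_mem (by simp [hA]) h.notMem).succ
  rcases h.cases_triple hA with rfl | rfl | rfl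
  · refine .inr ⟨hx, 4, .free₂₃ (fun v => ?_) (h.succ_eq₁ hA (by omega) (by omega)|>.trans ?_)
      hbq hqd hc, by omega⟩
    · rw [h.pending_succ, hp]
      simp [hP.not_pending_min hA hab (by omega)]
    · grind
  · by_cases hy : Pending A (t + 1) y
    · refine .inr ⟨hx, 6, .second' (fun v => ?_) (h.succ_eq₂ hA (by omega) (by omega)) hab hbq hqd
        hc, by have := hv' rfl; omega⟩
      rw [h.pending_succ, hp]
      simp [hy]
    · refine .inr ⟨hx, 4, .free₂₃ (fun v => ?_) (h.succ_eq₂ hA (by omega) (by omega))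
        (hab.trans hbq) hqd hc, by omega⟩
      rw [h.pending_succ, hp]
      simp [hy]
  · exact absurd h.lt (by omega)

lemma progress_third_of_new (hP : SepPath A c) {a b d q : ℕ} (h : Exchange A t y x)
    (hp : ∀ v, Pending A t v ↔ v = q) (hA : A t = {a, b, d}) (hab : a < b) (hbq : b < q)
    (hqd : q < d) (hx : x ∉ seen A t) (hy : y ≠ d) {v : ℤ} (hv : 10 ≤ v) : Progress A t x v := by
  have hqx : q < x := h.lt_of_notMem_seen hP hx ((hp q).2 rfl)
  have hxd : x ≠ d := by rintro rfl; exact h.notMem (by simp [hA])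
  rcases h.cases_triple hA with rfl | rfl | rfl
  · refine .inl ⟨hx, 9, .second (fun v => ?_) (h.succ_eq₁ hA (by omega) (by omega)|>.trans ?_)
      hbq hqx hqd hxd, by omega⟩
    · rw [h.pending_succ, hp]
      simp only [hP.not_pending_min hA hab (by omega)]
      grind
    · grind
  · by_cases hp' : Pending A (t + 1) y
    · refine .inl ⟨hx, 15, .seconds (fun v => ?_) (h.succ_eq₂ hA (by omega) (by omega)) hab hbq
        hqx hqd hxd, by omega⟩
      rw [h.pending_succ, hp]
      grind
    · refine .inl ⟨hx, 9, .second (fun v => ?_) (h.succ_eq₂ hA (by omega) (by omega))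
        (hab.trans hbq) hqx hqd hxd, by omega⟩
      rw [h.pending_succ, hp]
      grind
  · exact absurd rfl hy

lemma pending_succ_of_third (hP : SepPath A c) {a b d q : ℕ} (h : Exchange A t d x)
    (hp : ∀ v, Pending A t v ↔ v = q) (hA : A t = {a, b, d}) (hqd : q < d)
    (hx : x ∉ seen A t) (v : ℕ) : Pending A (t + 1) v ↔ v = q ∨ v = d := by
  have hq := (hp q).2 rfl
  have hqx : q < x := h.lt_of_notMem_seen hP hx hq
  have hd : d ∈ A t := by simp [hA]
  obtain ⟨s, hs, hqs⟩ := hq.exists_later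
  have hds : d ∈ A s := hP.sep t s q d (by omega) hqd hd hq.2.1 hqs
  have hpd : Pending A (t + 1) d :=
    ⟨mem_seen.2 ⟨t, by omega, hd⟩, by rw [h.mem_succ]; have := h.lt; grind, s, hs, hds⟩
  rw [h.pending_succ, hp]
  grind

lemma progress_third (hP : SepPath A c) {a b d q : ℕ} (h : Exchange A t y x)
    (hp : ∀ v, Pending A t v ↔ v = q) (hA : A t = {a, b, d}) (hab : a < b) (hbq : b < q)
    (hqd : q < d) : Progress A t x 13 := by
  by_cases hx : x ∈ seen A t
  · exact progress_third_of_pending hP h hp hA hab hbq hqd hx (by norm_num) (by norm_num)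
  by_cases hy : y = d
  · subst hy
    exact .inl ⟨hx, 18, .thirds (pending_succ_of_third hP h hp hA hqd hx)
      (h.succ_eq₃ hA (by omega) (by omega)) hab hbq hqd h.lt
      (Crossed.of_mem h.mem ((hp q).2 rfl).2.1).succ, by norm_num⟩
  · exact progress_third_of_new hP h hp hA hab hbq hqd hx hy (by norm_num)

lemma progress_third' (hP : SepPath A c) {a b d q : ℕ} (h : Exchange A t y x)
    (hp : ∀ v, Pending A t v ↔ v = q) (hA : A t = {a, b, d}) (hab : a < b) (hbq : b < q)
    (hqd : q < d) (hc : Crossed A t a b) : Progress A t x 10 := by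
  by_cases hx : x ∈ seen A t
  · refine progress_third_of_pending hP h hp hA hab hbq hqd hx (by norm_num) fun hy => ?_
    exact absurd hy.symm (h.sep_succ hP hc hab
      (fun hay => by have := hay.trans hy; omega) (by simp [hA]) (by simp [hA]))
  by_cases hy : y = d
  · subst hy
    exact .inl ⟨hx, 15, .thirds' (pending_succ_of_third hP h hp hA hqd hx)
      (h.succ_eq₃ hA (by omega) (by omega)) hab hbq hqd h.lt
      (Crossed.of_mem h.mem ((hp q).2 rfl).2.1).succ hc.succ, by norm_num⟩
  · exact progress_third_of_new hP h hp hA hab hbq hqd hx hy (by norm_num)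

lemma progress_thirds_of_not_pending (hP : SepPath A c) {a b d q r : ℕ} (h : Exchange A t y x)
    (hp : ∀ v, Pending A t v ↔ v = q ∨ v = r) (hA : A t = {a, b, d}) (hab : a < b)
    (hbq : b < q) (hqr : q < r) (hrd : r < d) (hc : Crossed A t q r)
    (hy : ¬ Pending A (t + 1) y) : Progress A t x 15 := by
  obtain ⟨hx, rfl, rfl | rfl⟩ := h.eq_of_thirds hP hp hA hab hbq hqr hrd hc
  · refine .inr ⟨hx.1, 9, .second (q := q) (fun v => ?_)
      (h.succ_eq₁ hA (by omega) (by omega)|>.trans ?_) hbq hqr (hqr.trans hrd) hrd.ne, by norm_num⟩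
    · rw [h.pending_succ, hp]
      grind
    · grind
  · refine .inr ⟨hx.1, 9, .second (q := q) (fun v => ?_)
      (h.succ_eq₂ hA (by omega) (by omega)) (hab.trans hbq) hqr (hqr.trans hrd) hrd.ne, by norm_num⟩
    rw [h.pending_succ, hp]
    grind

lemma Progress.mono {v w : ℤ} (h : Progress A t x v) (hvw : v ≤ w) : Progress A t x w := by
  rcases h with ⟨hx, u, hu, huv⟩ | ⟨hx, u, hu, huv⟩
  · exact .inl ⟨hx, u, hu, by omega⟩
  · exact .inr ⟨hx, u, hu, by omega⟩

lemma progress_thirds (hP : SepPath A c) {a b d q r : ℕ} (h : Exchange A t y x)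
    (hp : ∀ v, Pending A t v ↔ v = q ∨ v = r) (hA : A t = {a, b, d}) (hab : a < b)
    (hbq : b < q) (hqr : q < r) (hrd : r < d) (hc : Crossed A t q r) : Progress A t x 18 := by
  by_cases hy : Pending A (t + 1) y
  · have hxd : x ∉ A t := h.notMem
    obtain ⟨hx, rfl, rfl | rfl⟩ := h.eq_of_thirds hP hp hA hab hbq hqr hrd hc
    · exact absurd hy (hP.not_pending_min hA hab (by omega))
    · refine .inr ⟨hx.1, 12, .seconds' (q := y) (r := q) (fun v => ?_)
        (h.succ_eq₂ hA (by omega) (by omega)) hab hbq hqr hrd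
        (Crossed.of_mem (by simp [hA]) hxd).succ, by norm_num⟩
      rw [h.pending_succ, hp]
      grind
  · exact (progress_thirds_of_not_pending hP h hp hA hab hbq hqr hrd hc hy).mono (by norm_num)

lemma progress_thirds' (hP : SepPath A c) {a b d q r : ℕ} (h : Exchange A t y x)
    (hp : ∀ v, Pending A t v ↔ v = q ∨ v = r) (hA : A t = {a, b, d}) (hab : a < b)
    (hbq : b < q) (hqr : q < r) (hrd : r < d) (hc : Crossed A t q r) (hc' : Crossed A t a b) :
    Progress A t x 15 := by
  refine progress_thirds_of_not_pending hP h hp hA hab hbq hqr hrd hc fun hy => ?_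
  obtain ⟨-, -, rfl | rfl⟩ := h.eq_of_thirds hP hp hA hab hbq hqr hrd hc
  · exact hP.not_pending_min hA hab (by omega) hy
  · exact h.sep_succ hP hc' hab hab.ne (by simp [hA]) (by simp [hA]) rfl

lemma Potential.progress (hP : SepPath A c) (h : Exchange A t y x) {v : ℤ}
    (hv : Potential A t v) : Progress A t x v := by
  cases hv with
  | free hf => exact progress_free hP h hf
  | free₁₂ hf hA hab hbd hc => exact progress_free₁₂ hP h hf hA hab hbd hc
  | free₁₂₁₃ hf hA hab had _ hc hc' => exact progress_free₁₂₁₃ hP h hf hA hab had hc hc'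
  | free₂₃ hf hA hab hbd hc => exact progress_free₂₃ hP h hf hA hab hbd hc
  | freeAll hf hA hab hbd h₁ h₂ h₃ => exact progress_freeAll hP h hf hA hab hbd h₁ h₂ h₃
  | second hp hA haq hqd hqe hde => exact progress_second hP h hp hA haq hqd hqe hde
  | second' hp hA haq hqd hde hc => exact progress_second' hP h hp hA haq hqd hde hc
  | third hp hA hab hbq hqd => exact progress_third hP h hp hA hab hbq hqd
  | third' hp hA hab hbq hqd hc => exact progress_third' hP h hp hA hab hbq hqd hc
  | seconds hp hA haq hqr hrd hre hde =>
    exact progress_seconds hP h hp hA haq hqr hrd hre hde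
  | seconds' hp hA haq hqr hrd hde hc => exact progress_seconds' hP h hp hA haq hqr hrd hde hc
  | thirds hp hA hab hbq hqr hrd hc => exact progress_thirds hP h hp hA hab hbq hqr hrd hc
  | thirds' hp hA hab hbq hqr hrd hc hc' =>
    exact progress_thirds' hP h hp hA hab hbq hqr hrd hc hc'

lemma Potential.nonneg {v : ℤ} (hv : Potential A t v) : 0 ≤ v := by cases hv <;> norm_num

lemma Potential.stay {v : ℤ} (hv : Potential A t v) (h : A (t + 1) = A t) :
    Potential A (t + 1) v := by
  have hp : ∀ v, Pending A (t + 1) v ↔ Pending A t v := by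
    intro v
    have hs : seen A (t + 1) = seen A t := by
      rw [seen_succ, h, Finset.union_eq_left]; exact subset_seen
    refine ⟨fun ⟨h₁, h₂, s, hs', hv⟩ => ⟨hs ▸ h₁, h ▸ h₂, s, by omega, hv⟩, fun hv => ?_⟩
    obtain ⟨s, hs', hvs⟩ := hv.exists_later
    exact ⟨hs ▸ hv.1, h ▸ hv.2.1, s, hs', hvs⟩
  cases hv with
  | free hf => exact .free fun v => by rw [hp]; exact hf v
  | free₁₂ hf hA hab hbd hc =>
    exact .free₁₂ (fun v => by rw [hp]; exact hf v) (h.trans hA) hab hbd hc.succ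
  | free₁₂₁₃ hf hA hab had hbd hc hc' =>
    exact .free₁₂₁₃ (fun v => by rw [hp]; exact hf v) (h.trans hA) hab had hbd hc.succ hc'.succ
  | free₂₃ hf hA hab hbd hc =>
    exact .free₂₃ (fun v => by rw [hp]; exact hf v) (h.trans hA) hab hbd hc.succ
  | freeAll hf hA hab hbd h₁ h₂ h₃ =>
    exact .freeAll (fun v => by rw [hp]; exact hf v) (h.trans hA) hab hbd h₁.succ h₂.succ h₃.succ
  | second hq hA haq hqd hqe hde =>
    exact .second (fun v => by rw [hp]; exact hq v) (h.trans hA) haq hqd hqe hde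
  | second' hq hA haq hqd hde hc =>
    exact .second' (fun v => by rw [hp]; exact hq v) (h.trans hA) haq hqd hde hc.succ
  | third hq hA hab hbq hqd =>
    exact .third (fun v => by rw [hp]; exact hq v) (h.trans hA) hab hbq hqd
  | third' hq hA hab hbq hqd hc =>
    exact .third' (fun v => by rw [hp]; exact hq v) (h.trans hA) hab hbq hqd hc.succ
  | seconds hq hA haq hqr hrd hre hde =>
    exact .seconds (fun v => by rw [hp]; exact hq v) (h.trans hA) haq hqr hrd hre hde
  | seconds' hq hA haq hqr hrd hde hc =>
    exact .seconds' (fun v => by rw [hp]; exact hq v) (h.trans hA) haq hqr hrd hde hc.succ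
  | thirds hq hA hab hbq hqr hrd hc =>
    exact .thirds (fun v => by rw [hp]; exact hq v) (h.trans hA) hab hbq hqr hrd hc.succ
  | thirds' hq hA hab hbq hqr hrd hc hc' =>
    exact .thirds' (fun v => by rw [hp]; exact hq v) (h.trans hA) hab hbq hqr hrd hc.succ hc'.succ

lemma Potential.bound (hP : SepPath A c) {n N : ℕ} (hn : ∀ t, ∀ v ∈ A t, v < n) (hN : c N = 0)
    (m : ℕ) : ∀ (t : ℕ) (v : ℤ), N = t + m → Potential A t v →
      6 * (c t : ℤ) + 11 * (seen A t).card ≤ 11 * n + v := by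
  induction m with
  | zero =>
    intro t v hNt hv
    have h1 : (seen A t).card ≤ n := by
      simpa using Finset.card_le_card (t := Finset.range n) fun u hu => by
        obtain ⟨s, -, hs⟩ := mem_seen.1 hu
        simpa using hn s u hs
    have h2 := hv.nonneg
    have h3 : c t = 0 := by rwa [hNt] at hN
    rw [h3]
    push_cast
    omega
  | succ m ih =>
    rintro t v hN hv
    rcases hP.step t with ⟨hA, hc⟩ | ⟨y, x, hy, hx, hyx, hA, hc⟩
    · have := ih (t + 1) v (by omega) (hv.stay hA)
      rwa [seen_succ, Finset.union_eq_left.2 (hA ▸ subset_seen), ← hc] at this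
    · have h : Exchange A t y x := ⟨hy, hx, hyx, hA⟩
      have hs : seen A (t + 1) = insert x (seen A t) := by
        ext u
        rw [seen_succ, Finset.mem_union, h.mem_succ, Finset.mem_insert]
        have := @subset_seen A t u
        tauto
      rcases hv.progress hP h with ⟨hxs, w, hw, hwv⟩ | ⟨hxs, w, hw, hwv⟩
      · have := ih (t + 1) w (by omega) hw
        rw [hs, Finset.card_insert_of_notMem hxs] at this
        rw [hc]
        push_cast at this ⊢
        omega
      · have := ih (t + 1) w (by omega) hw
        rw [hs, Finset.insert_eq_of_mem hxs] at this
        rw [hc]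
        push_cast at this ⊢
        omega

theorem exchange_count_le (hP : SepPath A c) {n N : ℕ} (hn : ∀ t, ∀ v ∈ A t, v < n)
    (hN : c N = 0) : 6 * c 0 + 25 ≤ 11 * n := by
  have hs : seen A 0 = A 0 := by ext v; simp [mem_seen]
  have := Potential.bound hP hn hN N 0 8 (by omega) (.free fun v hv => hv.2.1 (hs ▸ hv.1))
  rw [hs, hP.card] at this
  omega

end SepPath

namespace ReducedWord

open Equiv

variable {n : ℕ}

/-- The inversions of `σ`, as pairs of values. -/
def inv (σ : Perm (Fin n)) : Finset (Fin n × Fin n) :=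
  Finset.univ.filter fun p => p.1 < p.2 ∧ σ.symm p.2 < σ.symm p.1

/-- The product of the simple transpositions listed in `l`. -/
def wordProd (n : ℕ) (l : List ℕ) : Perm (Fin n) := (l.map (sgen n)).prod

/-- The set of the first three values of `σ`. -/
def top (σ : Perm (Fin n)) : Finset ℕ :=
  (Finset.univ.filter fun k : Fin n => (k : ℕ) < 3).map (σ.toEmbedding.trans Fin.valEmbedding)

lemma mem_inv {σ : Perm (Fin n)} {u v : Fin n} :
    (u, v) ∈ inv σ ↔ u < v ∧ σ.symm v < σ.symm u := by simp [inv]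

lemma inv_one : inv (1 : Perm (Fin n)) = ∅ := by
  ext ⟨u, v⟩
  simp only [mem_inv, Finset.notMem_empty, iff_false, not_and, not_lt]
  exact fun h => h.le

lemma inv_subset_longest (σ : Perm (Fin n)) : inv σ ⊆ inv (longestPerm n) := by
  rintro ⟨u, v⟩ h
  rw [mem_inv] at h ⊢
  exact ⟨h.1, by simpa [longestPerm] using h.1⟩

lemma sgen_of_mem {i : ℕ} (h0 : 0 < i) (hi : i < n) :
    sgen n i = swap ⟨i - 1, by omega⟩ ⟨i, hi⟩ := dif_pos ⟨h0, hi⟩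

lemma sgen_mul_self (n i : ℕ) : sgen n i * sgen n i = 1 := by
  unfold sgen
  split_ifs <;> simp

lemma val_swap_adjacent {i : ℕ} (h0 : 0 < i) (hi : i < n) (k : Fin n) :
    (swap (⟨i - 1, by omega⟩ : Fin n) ⟨i, hi⟩ k : ℕ) =
      if (k : ℕ) = i - 1 then i else if (k : ℕ) = i then i - 1 else k := by
  rw [swap_apply_def]
  simp only [Fin.ext_iff]
  split_ifs <;> rfl

lemma symm_mul_swap (σ : Perm (Fin n)) (a b v : Fin n) :
    (σ * swap a b).symm v = swap a b (σ.symm v) := by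
  rw [symm_apply_eq]
  simp

lemma inv_mul_sgen {σ : Perm (Fin n)} {i : ℕ} (h0 : 0 < i) (hi : i < n)
    (h : σ ⟨i - 1, by omega⟩ < σ ⟨i, hi⟩) :
    inv (σ * sgen n i) = insert (σ ⟨i - 1, by omega⟩, σ ⟨i, hi⟩) (inv σ) := by
  ext ⟨u, v⟩
  obtain ⟨a, rfl⟩ := σ.surjective u
  obtain ⟨b, rfl⟩ := σ.surjective v
  rw [Finset.mem_insert, mem_inv, mem_inv, sgen_of_mem h0 hi, symm_mul_swap, symm_mul_swap,
    symm_apply_apply, symm_apply_apply, Prod.mk.injEq, σ.injective.eq_iff, σ.injective.eq_iff,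
    Fin.lt_def (a := swap _ _ _), val_swap_adjacent h0 hi, val_swap_adjacent h0 hi]
  have hba : b = ⟨i - 1, by omega⟩ → a = ⟨i, hi⟩ → ¬ σ a < σ b := by
    rintro rfl rfl; exact h.le.not_gt
  have hab : a = ⟨i - 1, by omega⟩ → b = ⟨i, hi⟩ → σ a < σ b := by
    rintro rfl rfl; exact h
  simp only [Fin.ext_iff, Fin.lt_def (a := b)] at hba hab ⊢
  split_ifs <;> grind

lemma notMem_inv {σ : Perm (Fin n)} {a b : Fin n} (h : a < b) : (σ a, σ b) ∉ inv σ := by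
  simp [mem_inv, h.le]

lemma card_inv_mul_sgen {σ : Perm (Fin n)} {i : ℕ} (h0 : 0 < i) (hi : i < n)
    (h : σ ⟨i - 1, by omega⟩ < σ ⟨i, hi⟩) :
    (inv (σ * sgen n i)).card = (inv σ).card + 1 := by
  rw [inv_mul_sgen h0 hi h,
    Finset.card_insert_of_notMem (notMem_inv (by simp only [Fin.mk_lt_mk]; omega))]

lemma ascent_or_card_le (σ : Perm (Fin n)) (i : ℕ) :
    (∃ (_ : 0 < i) (hi : i < n), σ ⟨i - 1, by omega⟩ < σ ⟨i, hi⟩) ∨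
      (inv (σ * sgen n i)).card ≤ (inv σ).card := by
  by_cases h : 0 < i ∧ i < n
  · obtain ⟨h0, hi⟩ := h
    rcases lt_trichotomy (σ ⟨i - 1, by omega⟩) (σ ⟨i, hi⟩) with h | h | h
    · exact .inl ⟨h0, hi, h⟩
    · have := Fin.ext_iff.1 (σ.injective h)
      simp only at this
      omega
    · have := card_inv_mul_sgen (σ := σ * sgen n i) h0 hi (by simpa [sgen_of_mem h0 hi] using h)
      rw [mul_assoc, sgen_mul_self, mul_one] at this
      exact .inr (by omega)
  · exact .inr (by simp [sgen, h])

lemma card_inv_mul_sgen_le (σ : Perm (Fin n)) (i : ℕ) :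
    (inv (σ * sgen n i)).card ≤ (inv σ).card + 1 := by
  rcases ascent_or_card_le σ i with ⟨h0, hi, h⟩ | h
  · exact (card_inv_mul_sgen h0 hi h).le
  · omega

lemma wordProd_cons (i : ℕ) (l : List ℕ) : wordProd n (i :: l) = sgen n i * wordProd n l := by
  simp [wordProd]

lemma wordProd_append (l l' : List ℕ) :
    wordProd n (l ++ l') = wordProd n l * wordProd n l' := by
  simp [wordProd]

lemma card_inv_mul_wordProd_le (l : List ℕ) (σ : Perm (Fin n)) :
    (inv (σ * wordProd n l)).card ≤ (inv σ).card + l.length := by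
  induction l generalizing σ with
  | nil => simp [wordProd]
  | cons i l ih =>
    rw [wordProd_cons, ← mul_assoc, List.length_cons]
    have := ih (σ * sgen n i)
    have := card_inv_mul_sgen_le σ i
    omega

lemma exists_ascent {u w : Perm (Fin n)} (hne : u ≠ w) (hsub : inv u ⊆ inv w) :
    ∃ (i : ℕ) (_ : 0 < i) (hi : i < n), u ⟨i - 1, by omega⟩ < u ⟨i, hi⟩ ∧
      (u ⟨i - 1, by omega⟩, u ⟨i, hi⟩) ∈ inv w := by
  by_contra! hno
  refine hne ?_
  rcases n with _ | n
  · exact Subsingleton.elim _ _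
  have hmono : StrictMono fun k => w.symm (u k) := by
    rw [Fin.strictMono_iff_lt_succ]
    intro k
    have hk := hno (k + 1) (by omega) (by omega)
    rcases lt_trichotomy (u k.castSucc) (u k.succ) with h | h | h
    · have h1 := hk h
      rw [mem_inv] at h1
      refine lt_of_le_of_ne (not_lt.1 fun h2 => h1 ⟨h, h2⟩) ?_
      simp [Fin.ext_iff]
    · simp [Fin.ext_iff] at h
    · exact (mem_inv.1 (hsub (mem_inv.2 ⟨h, by simp⟩))).2
  have h := (hmono.range_inj strictMono_id).1
    ((u.trans w.symm).surjective.range_eq.trans Set.range_id.symm)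
  ext k : 1
  simpa [symm_apply_eq] using congrFun h k

lemma exists_word (m : ℕ) : ∀ u w : Perm (Fin n), inv u ⊆ inv w →
    (inv w).card = (inv u).card + m → ∃ l, u * wordProd n l = w ∧ l.length = m := by
  induction m with
  | zero =>
    intro u w hsub hcard
    refine ⟨[], ?_, rfl⟩
    by_contra hne
    obtain ⟨i, h0, hi, h, hmem⟩ := exists_ascent (by simpa [wordProd] using hne) hsub
    rw [← Finset.eq_of_subset_of_card_le hsub hcard.le] at hmem
    exact notMem_inv (by simp only [Fin.mk_lt_mk]; omega) hmem
  | succ m ih =>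
    intro u w hsub hcard
    obtain ⟨i, h0, hi, h, hmem⟩ := exists_ascent (by rintro rfl; omega) hsub
    obtain ⟨l, hl, hlen⟩ := ih (u * sgen n i) w
      (by rw [inv_mul_sgen h0 hi h]; exact Finset.insert_subset hmem hsub)
      (by rw [card_inv_mul_sgen h0 hi h]; omega)
    exact ⟨i :: l, by rw [wordProd_cons, ← mul_assoc, hl], by simp [hlen]⟩

lemma isReducedWordFor_longest_iff {l : List ℕ} :
    IsReducedWordFor n l (longestPerm n) ↔
      wordProd n l = longestPerm n ∧ l.length = (inv (longestPerm n)).card := by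
  have hle : ∀ l', wordProd n l' = longestPerm n → (inv (longestPerm n)).card ≤ l'.length := by
    intro l' h
    have := card_inv_mul_wordProd_le l' (1 : Perm (Fin n))
    rwa [one_mul, h, inv_one, Finset.card_empty, zero_add] at this
  constructor
  · rintro ⟨h, hmin⟩
    obtain ⟨l', hl', hlen⟩ := exists_word _ 1 (longestPerm n) (inv_subset_longest 1)
      (by rw [inv_one, Finset.card_empty, zero_add])
    rw [one_mul] at hl'
    exact ⟨h, le_antisymm (hlen ▸ hmin l' hl') (hle l h)⟩
  · rintro ⟨h, hlen⟩
    exact ⟨h, fun l' h' => hlen ▸ hle l' h'⟩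

lemma mem_top {σ : Perm (Fin n)} {v : Fin n} : (v : ℕ) ∈ top σ ↔ (σ.symm v : ℕ) < 3 := by
  simp only [top, Finset.mem_map, Finset.mem_filter, Finset.mem_univ, true_and,
    Function.Embedding.trans_apply, Equiv.coe_toEmbedding, Fin.valEmbedding_apply, Fin.val_inj]
  constructor
  · rintro ⟨k, hk, rfl⟩
    simpa using hk
  · exact fun h => ⟨_, h, by simp⟩

lemma lt_of_mem_top {σ : Perm (Fin n)} {x : ℕ} (h : x ∈ top σ) : x < n := by
  simp only [top, Finset.mem_map, Function.Embedding.trans_apply, Fin.valEmbedding_apply] at h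
  obtain ⟨k, -, rfl⟩ := h
  exact Fin.is_lt _

lemma top_ext {σ : Perm (Fin n)} {S : Finset ℕ} (hS : ∀ v ∈ S, v < n)
    (h : ∀ v : Fin n, (σ.symm v : ℕ) < 3 ↔ (v : ℕ) ∈ S) : top σ = S := by
  ext x
  constructor <;> intro hx
  · exact (h ⟨x, lt_of_mem_top hx⟩).1 (mem_top (v := ⟨x, lt_of_mem_top hx⟩).1 hx)
  · exact mem_top (v := ⟨x, hS x hx⟩).2 ((h ⟨x, hS x hx⟩).2 hx)

lemma card_top (hn : 3 ≤ n) (σ : Perm (Fin n)) : (top σ).card = 3 := by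
  rw [top, Finset.card_map, Fin.card_filter_val_lt]
  omega

lemma top_mul_sgen_of_ne (σ : Perm (Fin n)) {i : ℕ} (hi3 : i ≠ 3) :
    top (σ * sgen n i) = top σ := by
  by_cases h : 0 < i ∧ i < n
  · refine top_ext (fun _ => lt_of_mem_top) fun v => ?_
    rw [mem_top, sgen_of_mem h.1 h.2, symm_mul_swap, val_swap_adjacent h.1 h.2]
    split_ifs <;> omega
  · simp [sgen, h]

lemma top_mul_sgen_three (hn : 3 < n) (σ : Perm (Fin n)) :
    top (σ * sgen n 3) =
      insert (σ ⟨3, hn⟩ : ℕ) ((top σ).erase (σ ⟨2, by omega⟩ : ℕ)) := by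
  refine top_ext ?_ fun v => ?_
  · intro x hx
    rcases Finset.mem_insert.1 hx with rfl | hx
    · exact Fin.is_lt _
    · exact lt_of_mem_top (Finset.mem_of_mem_erase hx)
  · obtain ⟨k, rfl⟩ := σ.surjective v
    rw [sgen_of_mem (by norm_num) hn, symm_mul_swap, val_swap_adjacent (by norm_num) hn,
      Finset.mem_insert, Finset.mem_erase, mem_top, symm_apply_apply, Fin.val_inj, Ne, Fin.val_inj,
      σ.injective.eq_iff, σ.injective.eq_iff]
    simp only [Fin.ext_iff]
    split_ifs <;> omega

lemma top_mul_wordProd {l : List ℕ} (hl : 3 ∉ l) (σ : Perm (Fin n)) :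
    top (σ * wordProd n l) = top σ := by
  induction l generalizing σ with
  | nil => simp [wordProd]
  | cons i l ih =>
    simp only [List.mem_cons, not_or] at hl
    rw [wordProd_cons, ← mul_assoc, ih hl.2, top_mul_sgen_of_ne _ (Ne.symm hl.1)]

/-- If the length of `l` is the number of inversions of its product, then the same holds for the
initial segments of `l`. -/
lemma card_inv_take {l : List ℕ} (h : l.length = (inv (wordProd n l)).card) {t : ℕ}
    (ht : t ≤ l.length) : (inv (wordProd n (l.take t))).card = t := by
  have h1 := card_inv_mul_wordProd_le (l.take t) (1 : Perm (Fin n))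
  have h2 := card_inv_mul_wordProd_le (l.drop t) (wordProd n (l.take t))
  rw [← wordProd_append, List.take_append_drop, ← h, List.length_drop] at h2
  rw [one_mul, inv_one, Finset.card_empty, List.length_take] at h1
  omega

lemma step_take {l : List ℕ} (h : l.length = (inv (wordProd n l)).card) {t : ℕ}
    (ht : t < l.length) :
    wordProd n (l.take (t + 1)) = wordProd n (l.take t) * sgen n l[t] ∧
    ∃ (_ : 0 < l[t]) (hi : l[t] < n),
      wordProd n (l.take t) ⟨l[t] - 1, by omega⟩ < wordProd n (l.take t) ⟨l[t], hi⟩ := by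
  have h1 : wordProd n (l.take (t + 1)) = wordProd n (l.take t) * sgen n l[t] := by
    rw [← List.take_concat_get' l t ht, wordProd_append]
    simp [wordProd]
  refine ⟨h1, (ascent_or_card_le _ _).resolve_right ?_⟩
  rw [← h1, card_inv_take h ht, card_inv_take h ht.le]
  omega

lemma inv_take_mono {l : List ℕ} (h : l.length = (inv (wordProd n l)).card) :
    Monotone fun t => inv (wordProd n (l.take t)) := by
  refine monotone_nat_of_le_succ fun t => ?_
  rcases lt_or_ge t l.length with ht | ht
  · obtain ⟨h1, h0, hi, hlt⟩ := step_take h ht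
    simp only [h1, inv_mul_sgen h0 hi hlt]
    exact Finset.subset_insert _ _
  · simp only [List.take_of_length_le ht, List.take_of_length_le (ht.trans (Nat.le_succ t))]
    exact le_rfl

lemma sepPath_of_word (hn : 4 ≤ n) {l : List ℕ} (h : l.length = (inv (wordProd n l)).card) :
    SepPath (fun t => top (wordProd n (l.take t))) (fun t => (l.drop t).count 3) where
  card t := card_top (by omega) _
  step t := by
    rcases lt_or_ge t l.length with ht | ht
    · obtain ⟨h1, h0, hi, hlt⟩ := step_take h ht
      rw [List.drop_eq_getElem_cons ht]
      by_cases h3 : l[t] = 3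
      · right
        simp only [h3] at h1 hlt
        refine ⟨_, _, ?_, ?_, hlt, ?_, by simp [h3]⟩
        · rw [mem_top, symm_apply_apply]; norm_num
        · rw [mem_top, symm_apply_apply]; norm_num
        · rw [h1, top_mul_sgen_three (by omega)]
      · left
        rw [h1, top_mul_sgen_of_ne _ h3, List.count_cons_of_ne h3]
        exact ⟨rfl, rfl⟩
    · left
      rw [List.take_of_length_le ht, List.take_of_length_le (ht.trans (Nat.le_succ t)),
        List.drop_of_length_le ht, List.drop_of_length_le (ht.trans (Nat.le_succ t))]
      exact ⟨rfl, rfl⟩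
  sep s t i j hst hij hj hi hit := by
    lift i to Fin n using lt_of_mem_top hit
    lift j to Fin n using lt_of_mem_top hj
    rw [mem_top] at *
    have := mem_inv.1 (inv_take_mono h hst (mem_inv.2 ⟨hij, by rw [Fin.lt_def]; omega⟩))
    have h2 := this.2
    rw [Fin.lt_def] at h2
    omega

theorem count_le (hn : 4 ≤ n) {l : List ℕ} (h : IsReducedWordFor n l (longestPerm n)) :
    6 * l.count 3 + 25 ≤ 11 * n := by
  obtain ⟨h1, h2⟩ := isReducedWordFor_longest_iff.1 h
  have := (sepPath_of_word hn (h1 ▸ h2)).exchange_count_le (n := n) (N := l.length)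
    (fun t v hv => lt_of_mem_top hv) (by simp)
  simpa using this

lemma exists_perm_of_key {f : Fin n → ℕ} (hf : Function.Injective f) :
    ∃ σ : Perm (Fin n), ∀ u v, σ.symm u < σ.symm v ↔ f u < f v := by
  have h : StrictMono (f ∘ Tuple.sort f) :=
    (Tuple.monotone_sort f).strictMono_of_injective (hf.comp (Tuple.sort f).injective)
  exact ⟨Tuple.sort f, fun u v => by simpa using (h.lt_iff_lt (a := (Tuple.sort f).symm u)
    (b := (Tuple.sort f).symm v)).symm⟩

lemma top_eq_of_lt (hn : 3 ≤ n) {σ : Perm (Fin n)} {S : Finset ℕ} (hS : S.card = 3)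
    (hlt : ∀ v ∈ S, v < n)
    (h : ∀ u v : Fin n, (u : ℕ) ∈ S → (v : ℕ) ∉ S → σ.symm u < σ.symm v) : top σ = S := by
  have hcard : (top σ).card = S.card := (card_top hn σ).trans hS.symm
  refine Finset.eq_of_subset_of_card_le (fun v hv => ?_) hcard.ge
  by_contra hvS
  have hne : ¬ S ⊆ top σ := fun hsub => hvS (Finset.eq_of_subset_of_card_le hsub hcard.le ▸ hv)
  obtain ⟨u, huS, hu⟩ := Finset.not_subset.1 hne
  lift u to Fin n using hlt u huS
  lift v to Fin n using lt_of_mem_top hv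
  have := h u v huS hvS
  rw [mem_top] at hv hu
  rw [Fin.lt_def] at this
  omega

lemma exists_perm_of_exchange (hn : 3 ≤ n) {A : ℕ → Finset ℕ} {t x y : ℕ}
    (h : SepPath.Exchange A t y x) (hcard : (A (t + 1)).card = 3) (hlt : ∀ v ∈ A (t + 1), v < n)
    (hsep : ∀ i j, i < j → SepPath.Crossed A t i j → i ∈ A (t + 1) → j ∈ A (t + 1))
    {σ : Perm (Fin n)} (htop : top σ = A t)
    (hinv : ∀ u v, (u, v) ∈ inv σ → SepPath.Crossed A t u v) :
    ∃ τ : Perm (Fin n), inv σ ⊆ inv τ ∧ top τ = A (t + 1) ∧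
      ∀ u v, (u, v) ∈ inv τ → SepPath.Crossed A (t + 1) u v := by
  have hmem : ∀ v : Fin n, (v : ℕ) ∈ A t ↔ (σ.symm v : ℕ) < 3 := fun v => htop ▸ mem_top
  have hyx := h.lt
  have hyA := h.mem
  have hxA := h.notMem
  have hsucc := fun v => h.mem_succ (v := v)
  obtain ⟨f, hfx, hfy, hfA, hfn⟩ : ∃ f : Fin n → ℕ, (∀ v : Fin n, (v : ℕ) = x → f v = 3) ∧
      (∀ v : Fin n, (v : ℕ) = y → f v = 4) ∧
      (∀ v : Fin n, (v : ℕ) ≠ y → (v : ℕ) ∈ A t → f v = σ.symm v) ∧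
      ∀ v : Fin n, (v : ℕ) ≠ x → (v : ℕ) ∉ A t → f v = 5 + σ.symm v :=
    ⟨fun v => if (v : ℕ) = x then 3 else if (v : ℕ) = y then 4 else
      if (v : ℕ) ∈ A t then σ.symm v else 5 + σ.symm v, by grind, by grind, by grind, by grind⟩
  have hcases : ∀ v : Fin n, ((v : ℕ) = x ∧ f v = 3 ∧ 3 ≤ (σ.symm v : ℕ)) ∨
      ((v : ℕ) = y ∧ f v = 4 ∧ (σ.symm v : ℕ) < 3) ∨
      ((v : ℕ) ≠ x ∧ (v : ℕ) ≠ y ∧ (v : ℕ) ∈ A t ∧ f v = σ.symm v ∧ (σ.symm v : ℕ) < 3) ∨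
      ((v : ℕ) ≠ x ∧ (v : ℕ) ≠ y ∧ (v : ℕ) ∉ A t ∧ f v = 5 + σ.symm v ∧ 3 ≤ (σ.symm v : ℕ)) := by
    intro v
    have := hmem v
    grind
  have hinj : Function.Injective f := by
    intro u v huv
    have hsymm : (σ.symm u : ℕ) = σ.symm v → u = v := fun h => σ.symm.injective (Fin.ext h)
    rw [Fin.ext_iff] at hsymm ⊢
    rcases hcases u with hu | hu | hu | hu <;> rcases hcases v with hv | hv | hv | hv <;> omega
  obtain ⟨τ, hτ⟩ := exists_perm_of_key hinj
  refine ⟨τ, ?_, ?_, ?_⟩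
  · rintro ⟨u, v⟩ huv
    have hc := hinv u v huv
    rw [mem_inv] at huv ⊢
    refine ⟨huv.1, (hτ _ _).2 ?_⟩
    have h1 := hsep u v huv.1 hc
    rw [Fin.lt_def, Fin.lt_def] at huv
    rw [hsucc, hsucc] at h1
    rcases hcases u with hu | hu | hu | hu <;> rcases hcases v with hv | hv | hv | hv <;> grind
  · refine top_eq_of_lt hn hcard hlt fun u v hu hv => (hτ _ _).2 ?_
    rw [hsucc] at hu hv
    rcases hcases u with hu | hu | hu | hu <;> rcases hcases v with hv | hv | hv | hv <;> grind
  · intro u v huv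
    have h1 := mem_inv.1 huv
    rw [hτ] at h1
    have h2 : SepPath.Crossed A t u v ∨ (v : ℕ) ∈ A (t + 1) ∧ (u : ℕ) ∉ A (t + 1) := by
      have h3 : σ.symm v < σ.symm u → SepPath.Crossed A t u v :=
        fun h3 => hinv u v (mem_inv.2 ⟨h1.1, h3⟩)
      have h4 := SepPath.Crossed.of_mem (A := A) (t := t) (i := u) (j := v)
      rw [Fin.lt_def] at h1 h3
      rw [hsucc, hsucc]
      rcases hcases u with hu | hu | hu | hu <;> rcases hcases v with hv | hv | hv | hv <;> grind
    exact h2.elim (fun h => h.succ) fun h => .of_mem h.1 h.2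

lemma top_one (hn : 3 ≤ n) : top (1 : Perm (Fin n)) = {0, 1, 2} := by
  refine top_ext (fun v hv => ?_) fun v => ?_
  · simp only [Finset.mem_insert, Finset.mem_singleton] at hv
    omega
  · simp only [Finset.mem_insert, Finset.mem_singleton, show (1 : Perm (Fin n)).symm v = v from rfl]
    omega

/-- A sequence of `N` exchanges starting at `{0, 1, 2}` and satisfying the separation condition
is realized by a reduced word for the longest permutation. -/
theorem exists_le_count (hn : 3 ≤ n) {A : ℕ → Finset ℕ} {N : ℕ} (h0 : A 0 = {0, 1, 2})
    (hcard : ∀ t ≤ N, (A t).card = 3) (hlt : ∀ t ≤ N, ∀ v ∈ A t, v < n)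
    (hex : ∀ t < N, ∃ y x, SepPath.Exchange A t y x)
    (hsep : ∀ s t i j, s ≤ t → t ≤ N → i < j → j ∈ A s → i ∉ A s → i ∈ A t → j ∈ A t) :
    ∃ l, IsReducedWordFor n l (longestPerm n) ∧ N ≤ l.count 3 := by
  have key : ∀ t ≤ N, ∃ l, l.length = (inv (wordProd n l)).card ∧ t ≤ l.count 3 ∧
      top (wordProd n l) = A t ∧
      ∀ u v, (u, v) ∈ inv (wordProd n l) → SepPath.Crossed A t u v := by
    intro t
    induction t with
    | zero =>
      have h1 : wordProd n [] = 1 := rfl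
      exact fun _ => ⟨[], by simp [h1, inv_one], by simp, by rw [h1, top_one hn, h0],
        by simp [h1, inv_one]⟩
    | succ t ih =>
      intro ht
      obtain ⟨l, hlen, hcount, htop, hinv⟩ := ih (by omega)
      obtain ⟨y, x, h⟩ := hex t ht
      obtain ⟨τ, hsub, hτ, hτinv⟩ := exists_perm_of_exchange hn h (hcard _ ht) (hlt _ ht)
        (fun i j hij ⟨s, hs, hj, hi⟩ => hsep s (t + 1) i j (by omega) ht hij hj hi) htop hinv
      have hle := Finset.card_le_card hsub
      obtain ⟨l', hl', hlen'⟩ := exists_word ((inv τ).card - (inv (wordProd n l)).card) _ _ hsub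
        (by omega)
      have h3 : 3 ∈ l' := by
        by_contra h3
        have h4 := top_mul_wordProd h3 (wordProd n l)
        rw [hl', hτ, htop] at h4
        exact h.notMem (h4 ▸ h.mem_succ.2 (.inl rfl))
      rw [← wordProd_append] at hl'
      refine ⟨l ++ l', ?_, ?_, hl' ▸ hτ, hl' ▸ hτinv⟩
      · rw [hl', List.length_append]
        omega
      · rw [List.count_append]
        have := List.count_pos_iff.2 h3
        omega
  obtain ⟨l, hlen, hcount, -, -⟩ := key N le_rfl
  have hsub := inv_subset_longest (wordProd n l)
  have hle := Finset.card_le_card hsub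
  obtain ⟨l', hl', hlen'⟩ := exists_word
    ((inv (longestPerm n)).card - (inv (wordProd n l)).card) _ _ hsub (by omega)
  refine ⟨l ++ l', isReducedWordFor_longest_iff.2 ⟨by rw [wordProd_append, hl'], ?_⟩, ?_⟩
  · rw [List.length_append]
    omega
  · rw [List.count_append]
    omega

end ReducedWord

/-- `T` arises from `S` by exchanging an element for a larger one. -/
def ExchangeStep (S T : Finset ℕ) : Prop :=
  ∃ y ∈ S, ∃ x ∈ T, x ∉ S ∧ y < x ∧ T = insert x (S.erase y)

/-- No `i < j` with `j` but not `i` in `S`, and `i` but not `j` in `T`. -/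
def SeparatedFrom (S T : Finset ℕ) : Prop := ∀ j ∈ S, ∀ i ∈ T, i < j → i ∉ S → j ∈ T

instance : DecidableRel ExchangeStep := fun S T => by unfold ExchangeStep; infer_instance

instance : DecidableRel SeparatedFrom := fun S T => by unfold SeparatedFrom; infer_instance

/-- A separated sequence of exchanges of 3-element subsets of `{0, …, n - 1}` starting at
`{0, 1, 2}`. -/
structure IsExchangePath (n : ℕ) (P : List (Finset ℕ)) : Prop where
  head : P.head? = some {0, 1, 2}
  card : ∀ S ∈ P, S.card = 3
  lt : ∀ S ∈ P, ∀ v ∈ S, v < n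
  chain : P.IsChain ExchangeStep
  sep : P.Pairwise SeparatedFrom

namespace IsExchangePath

/-- Eleven sets that prolong an exchange path shifted by six. -/
def headBlock : List (Finset ℕ) :=
  [{0, 1, 2}, {0, 1, 3}, {0, 1, 4}, {0, 3, 4}, {1, 3, 4}, {2, 3, 4}, {3, 4, 5}, {3, 4, 6},
    {4, 5, 6}, {4, 6, 7}, {5, 6, 7}]

variable {n : ℕ} {P : List (Finset ℕ)}

lemma prolong (h : IsExchangePath n P) :
    IsExchangePath (n + 6) (headBlock ++ P.map (Finset.map (addRightEmbedding 6))) where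
  head := rfl
  card S hS := by
    rcases List.mem_append.1 hS with hS | hS
    · have h1 : ∀ S ∈ headBlock, S.card = 3 := by decide
      exact h1 S hS
    · obtain ⟨T, hT, rfl⟩ := List.mem_map.1 hS
      rw [Finset.card_map, h.card T hT]
  lt S hS v hv := by
    rcases List.mem_append.1 hS with hS | hS
    · have h1 : ∀ S ∈ headBlock, ∀ v ∈ S, v < 8 := by decide
      have h2 := h.lt {0, 1, 2} (List.mem_of_mem_head? h.head) 2 (by simp)
      have := h1 S hS v hv
      omega
    · obtain ⟨T, hT, rfl⟩ := List.mem_map.1 hS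
      obtain ⟨w, hw, rfl⟩ := Finset.mem_map.1 hv
      exact Nat.add_lt_add_right (h.lt T hT w hw) 6
  chain := by
    refine List.isChain_append.2 ⟨by decide, ?_, ?_⟩
    · rw [List.isChain_map]
      refine h.chain.imp fun S T => ?_
      rintro ⟨y, hy, x, hx, hxS, hyx, rfl⟩
      exact ⟨y + 6, Finset.mem_map_of_mem _ hy, x + 6, Finset.mem_map_of_mem _ hx,
        by simpa using hxS, by omega, by simp [Finset.map_insert, Finset.map_erase]⟩
    · rw [List.head?_map, h.head]
      decide
  sep := by
    refine List.pairwise_append.2 ⟨by decide, ?_, ?_⟩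
    · rw [List.pairwise_map]
      refine h.sep.imp fun {S T} hST => ?_
      intro j hj i hi hij hiS
      obtain ⟨j, hjS, rfl⟩ := Finset.mem_map.1 hj
      obtain ⟨i, hiT, rfl⟩ := Finset.mem_map.1 hi
      refine Finset.mem_map_of_mem _ (hST j hjS i hiT ?_ fun h => hiS (Finset.mem_map_of_mem _ h))
      simpa using hij
    · intro S hS T hT j hj i hi hij hiS
      obtain ⟨T, -, rfl⟩ := List.mem_map.1 hT
      obtain ⟨i, -, rfl⟩ := Finset.mem_map.1 hi
      have h1 : ∀ S ∈ headBlock, ∀ j ∈ S, j < 8 ∧ (j = 7 → 6 ∈ S) := by decide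
      obtain ⟨h2, h3⟩ := h1 S hS j hj
      simp only [addRightEmbedding_apply] at hij hiS
      obtain rfl : i = 0 := by omega
      exact absurd (h3 (by omega)) hiS

lemma exists_long (n : ℕ) (hn : 4 ≤ n) :
    ∃ P, IsExchangePath n P ∧ 11 * n ≤ 6 * P.length + 24 := by
  induction n using Nat.strong_induction_on with
  | _ n ih =>
  by_cases h10 : 10 ≤ n
  · obtain ⟨n, rfl⟩ := Nat.exists_eq_add_of_le' (show 6 ≤ n by omega)
    obtain ⟨P, hP, hlen⟩ := ih n (by omega) (by omega)
    refine ⟨_, hP.prolong, ?_⟩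
    simp only [List.length_append, List.length_map, headBlock, List.length_cons, List.length_nil]
    omega
  · have hn' : n < 10 := by omega
    clear ih h10
    interval_cases n
    · exact ⟨[{0, 1, 2}, {0, 1, 3}, {0, 2, 3}, {1, 2, 3}],
        ⟨rfl, by decide, by decide, by decide, by decide⟩, by decide⟩
    · exact ⟨headBlock.take 6, ⟨rfl, by decide, by decide, by decide, by decide⟩, by decide⟩
    · exact ⟨headBlock.take 7, ⟨rfl, by decide, by decide, by decide, by decide⟩, by decide⟩
    · exact ⟨headBlock.take 9, ⟨rfl, by decide, by decide, by decide, by decide⟩, by decide⟩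
    · exact ⟨headBlock, ⟨rfl, by decide, by decide, by decide, by decide⟩, by decide⟩
    · exact ⟨headBlock.take 7 ++ [{4, 5, 6}, {4, 5, 7}, {4, 5, 8}, {4, 7, 8}, {5, 7, 8}, {6, 7, 8}],
        ⟨rfl, by decide, by decide, by decide, by decide⟩, by decide⟩

lemma exists_le_count (hn : 3 ≤ n) (hP : IsExchangePath n P) :
    ∃ l, IsReducedWordFor n l (longestPerm n) ∧ P.length ≤ l.count 3 + 1 := by
  have h0 : 0 < P.length := List.length_pos_iff.2 fun h => by simpa [h] using hP.head
  have hget : ∀ t (ht : t < P.length), P.getD t ∅ = P[t] := fun t ht =>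
    List.getD_eq_getElem P ∅ ht
  suffices h : ∃ l, IsReducedWordFor n l (longestPerm n) ∧ P.length - 1 ≤ l.count 3 by
    obtain ⟨l, hl, hcount⟩ := h
    exact ⟨l, hl, by omega⟩
  refine ReducedWord.exists_le_count hn (A := fun t => P.getD t ∅) ?_ ?_ ?_ ?_ ?_
  · rw [hget 0 h0]
    simpa [List.head?_eq_getElem?, List.getElem?_eq_some_iff, h0] using hP.head
  · intro t ht
    rw [hget t (by omega)]
    exact hP.card _ (List.getElem_mem _)
  · intro t ht
    rw [hget t (by omega)]
    exact hP.lt _ (List.getElem_mem _)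
  · intro t ht
    obtain ⟨y, hy, x, -, hx, hyx, h⟩ := List.isChain_iff_getElem.1 hP.chain t (by omega)
    refine ⟨y, x, ?_⟩
    rw [← hget t (by omega), ← hget (t + 1) (by omega)] at *
    exact ⟨hy, hx, hyx, h⟩
  · intro s t i j hst ht hij hj hi hit
    rcases hst.eq_or_lt with rfl | hst
    · exact absurd hit hi
    · have h := List.pairwise_iff_getElem.1 hP.sep s t (by omega) (by omega) hst
      rw [← hget s (by omega), ← hget t (by omega)] at h
      exact h j hj i hit hij hi

end IsExchangePath

theorem stmt9 (n : ℕ) (hn : 4 ≤ n) : (Mmax 3 n : ℤ) = ⌈(11 * (n : ℚ)) / 6⌉ - 5 := by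
  obtain ⟨P, hP, hlen⟩ := IsExchangePath.exists_long n hn
  obtain ⟨l, hl, hcount⟩ := hP.exists_le_count (by omega)
  have hle := ReducedWord.count_le hn hl
  have hM : Mmax 3 n = l.count 3 := by
    refine IsGreatest.csSup_eq ⟨⟨l, hl, rfl⟩, ?_⟩
    rintro _ ⟨l', hl', rfl⟩
    have := ReducedWord.count_le hn hl'
    omega
  have h1 : 6 * (l.count 3 : ℚ) + 25 ≤ 11 * n := by exact_mod_cast hle
  have h2 : 11 * (n : ℚ) ≤ 6 * l.count 3 + 30 := by
    exact_mod_cast (show 11 * n ≤ 6 * l.count 3 + 30 by omega)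
  rw [hM, eq_sub_iff_add_eq, eq_comm, Int.ceil_eq_iff]
  push_cast
  constructor <;> linarith
end

section
/- For any monotone weakly separated path P = (A_0, ..., A_N) of k-element subsets of [n] with A_0 = {1, 2, ..., k}, there exists a reduced word i for some permutation in S_n such that the sequence of k-sets extracted from i at its occurrences of s_k equals P. -/
/-- The set `{w(1), …, w(k)}` (1-indexed values) for `w ∈ S_n`. -/
def topSet (n k : ℕ) (w : Equiv.Perm (Fin n)) : Finset ℕ :=
  Finset.image (fun j => (w j : ℕ) + 1)
    (Finset.univ.filter (fun j : Fin n => (j : ℕ) < k))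

/-- The prefixes of `l` ending at each occurrence of the letter `k`. -/
def kPrefixes (k : ℕ) (l : List ℕ) : List (List ℕ) :=
  ((List.range l.length).filter (fun a => l[a]? = some k)).map (fun a => l.take (a + 1))

/-- The sequence `(A_0, A_1, …, A_N)` of `k`-sets extracted from the word `l`. -/
def extractedPath (n k : ℕ) (l : List ℕ) : List (Finset ℕ) :=
  topSet n k 1 :: (kPrefixes k l).map (fun p => topSet n k ((p.map (sgen n)).prod))

open Finset in
/-- The inversions of `w`, as pairs of values `(a, b)` with `a < b` and `b` before `a`. -/
def inversions {n : ℕ} (w : Equiv.Perm (Fin n)) : Finset (Fin n × Fin n) :=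
  univ.filter fun p => p.1 < p.2 ∧ w.symm p.2 < w.symm p.1

theorem mem_inversions {n : ℕ} {w : Equiv.Perm (Fin n)} {a b : Fin n} :
    (a, b) ∈ inversions w ↔ a < b ∧ w.symm b < w.symm a := by
  simp [inversions]

theorem inversions_one (n : ℕ) : inversions (1 : Equiv.Perm (Fin n)) = ∅ := by
  ext ⟨a, b⟩
  simp only [mem_inversions, Finset.notMem_empty, iff_false]
  exact fun h => lt_asymm h.1 h.2

theorem symm_mul_swap_apply {n : ℕ} (w : Equiv.Perm (Fin n)) (p q a : Fin n) :
    (w * Equiv.swap p q).symm a = Equiv.swap p q (w.symm a) := by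
  rw [Equiv.symm_apply_eq]
  simp

theorem inversions_mul_swap_subset {n : ℕ} (w : Equiv.Perm (Fin n)) {p q : Fin n}
    (hpq : (q : ℕ) = p + 1) :
    inversions (w * Equiv.swap p q) ⊆ insert (w p, w q) (inversions w) := by
  rintro ⟨a, b⟩ h
  obtain ⟨r, rfl⟩ := w.surjective a
  obtain ⟨s, rfl⟩ := w.surjective b
  simp only [mem_inversions, symm_mul_swap_apply, Finset.mem_insert, Prod.mk.injEq,
    EmbeddingLike.apply_eq_iff_eq, Equiv.symm_apply_apply, Equiv.swap_apply_def] at h ⊢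
  obtain ⟨h1, h2⟩ := h
  have hne : r ≠ s := by rintro rfl; exact lt_irrefl _ h1
  simp only [Fin.lt_def, Fin.ext_iff, ne_eq] at *
  split_ifs at h2 <;> omega

theorem inversions_mul_swap {n : ℕ} (w : Equiv.Perm (Fin n)) {p q : Fin n}
    (hpq : (q : ℕ) = p + 1) (hw : w p < w q) :
    inversions (w * Equiv.swap p q) = insert (w p, w q) (inversions w) := by
  refine (inversions_mul_swap_subset w hpq).antisymm ?_
  rintro ⟨a, b⟩ h
  obtain ⟨r, rfl⟩ := w.surjective a
  obtain ⟨s, rfl⟩ := w.surjective b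
  simp only [mem_inversions, symm_mul_swap_apply, Finset.mem_insert, Prod.mk.injEq,
    EmbeddingLike.apply_eq_iff_eq, Equiv.symm_apply_apply] at h ⊢
  rcases h with ⟨rfl, rfl⟩ | ⟨h1, h2⟩
  · refine ⟨hw, ?_⟩
    rw [Equiv.swap_apply_left, Equiv.swap_apply_right, Fin.lt_def]
    omega
  · refine ⟨h1, ?_⟩
    have hne : ¬ (r = q ∧ s = p) := by
      rintro ⟨rfl, rfl⟩
      exact lt_asymm h1 hw
    simp only [Equiv.swap_apply_def]
    simp only [Fin.lt_def, Fin.ext_iff] at *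
    split_ifs <;> omega

theorem card_inversions_prod_le (n : ℕ) (l : List ℕ) :
    (inversions (l.map (sgen n)).prod).card ≤ l.length := by
  induction l using List.reverseRecOn with
  | nil => simp [inversions_one]
  | append_singleton l i ih =>
    simp only [List.map_append, List.map_cons, List.map_nil, List.prod_append,
      List.prod_singleton, List.length_append, List.length_singleton]
    unfold sgen
    split_ifs with h
    · refine (Finset.card_le_card (inversions_mul_swap_subset _ ?_)).trans
        ((Finset.card_insert_le _ _).trans (Nat.succ_le_succ ih))
      simp only
      omega
    · rw [mul_one]
      exact ih.trans (Nat.le_succ _)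

theorem isReducedWordFor_of_length_eq {n : ℕ} {l : List ℕ}
    (h : l.length = (inversions (l.map (sgen n)).prod).card) :
    IsReducedWordFor n l (l.map (sgen n)).prod :=
  ⟨rfl, fun l' hl' => by rw [h, ← hl']; exact card_inversions_prod_le n l'⟩

/-- If the inversions of `w` lie strictly inside a biclosed set `J`, then some ascent of `w`
at adjacent positions is a pair of `J`. -/
theorem exists_ascent_mem {n : ℕ} (w : Equiv.Perm (Fin n)) (J : Finset (Fin n × Fin n))
    (hlt : ∀ a b, (a, b) ∈ J → a < b)
    (htrans : ∀ a b c, (a, b) ∈ J → (b, c) ∈ J → (a, c) ∈ J)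
    (hcotrans : ∀ a b c, a < b → b < c → (a, c) ∈ J → (a, b) ∈ J ∨ (b, c) ∈ J)
    (hsub : inversions w ⊆ J) (hne : inversions w ≠ J) :
    ∃ p q : Fin n, (q : ℕ) = p + 1 ∧ w p < w q ∧ (w p, w q) ∈ J := by
  have key : ∀ d : ℕ, ∀ p q : Fin n, (q : ℕ) = p + 1 + d → (w p, w q) ∈ J →
      ∃ p q : Fin n, (q : ℕ) = p + 1 ∧ w p < w q ∧ (w p, w q) ∈ J := by
    intro d
    induction d using Nat.strong_induction_on with
    | _ d ih =>
      intro p q hpq hJ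
      rcases Nat.eq_zero_or_pos d with rfl | hd
      · exact ⟨p, q, hpq, hlt _ _ hJ, hJ⟩
      have hq := q.isLt
      obtain ⟨r, hr⟩ : ∃ r : Fin n, (r : ℕ) = p + 1 := ⟨⟨p + 1, by omega⟩, rfl⟩
      have left : (w p, w r) ∈ J → ∃ p q : Fin n, (q : ℕ) = p + 1 ∧ w p < w q ∧ (w p, w q) ∈ J :=
        ih 0 hd p r hr
      have right : (w r, w q) ∈ J →
          ∃ p q : Fin n, (q : ℕ) = p + 1 ∧ w p < w q ∧ (w p, w q) ∈ J :=
        ih (d - 1) (by omega) r q (by omega)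
      have hrp : w r ≠ w p := fun h => by have := w.injective h; subst this; omega
      have hrq : w r ≠ w q := fun h => by have := w.injective h; subst this; omega
      rcases lt_or_gt_of_ne hrp with h1 | h1
      · refine right (htrans _ _ _ (hsub (mem_inversions.2 ⟨h1, ?_⟩)) hJ)
        simp only [Equiv.symm_apply_apply, Fin.lt_def]
        omega
      rcases lt_or_gt_of_ne hrq with h2 | h2
      · exact (hcotrans _ _ _ h1 h2 hJ).elim left right
      · refine left (htrans _ _ _ hJ (hsub (mem_inversions.2 ⟨h2, ?_⟩)))
        simp only [Equiv.symm_apply_apply, Fin.lt_def]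
        omega
  obtain ⟨⟨a, b⟩, hab, hnot⟩ := Finset.exists_of_ssubset (hsub.ssubset_of_ne hne)
  have hle : w.symm a ≤ w.symm b := not_lt.1 fun h => hnot (mem_inversions.2 ⟨hlt _ _ hab, h⟩)
  have hne' : w.symm a ≠ w.symm b := fun h => (hlt _ _ hab).ne (w.symm.injective h)
  have hlt' : (w.symm a : ℕ) < w.symm b := lt_of_le_of_ne hle (Fin.val_ne_of_ne hne')
  exact key (w.symm b - w.symm a - 1) (w.symm a) (w.symm b) (by omega) (by simpa using hab)

theorem kPrefixes_append_singleton (k : ℕ) (l : List ℕ) (i : ℕ) :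
    kPrefixes k (l ++ [i]) = kPrefixes k l ++ if i = k then [l ++ [i]] else [] := by
  unfold kPrefixes
  rw [List.length_append, List.length_singleton, List.range_succ, List.filter_append,
    List.map_append]
  congr 1
  · have hf : (List.range l.length).filter (fun a => decide ((l ++ [i])[a]? = some k)) =
        (List.range l.length).filter (fun a => decide (l[a]? = some k)) := by
      refine List.filter_congr fun a ha => ?_
      rw [List.getElem?_append_left (List.mem_range.1 ha)]
    rw [hf]
    refine List.map_congr_left fun a ha => ?_
    have := List.mem_range.1 (List.mem_filter.1 ha).1
    rw [List.take_append_of_le_length (by omega)]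
  · by_cases h : i = k <;> simp [h]

theorem extractedPath_append_singleton (n k : ℕ) (l : List ℕ) (i : ℕ) :
    extractedPath n k (l ++ [i]) = extractedPath n k l ++
      if i = k then [topSet n k ((l.map (sgen n)).prod * sgen n i)] else [] := by
  unfold extractedPath
  rw [kPrefixes_append_singleton]
  split_ifs <;> simp

theorem mem_topSet {n k : ℕ} {w : Equiv.Perm (Fin n)} {a : Fin n} :
    (a : ℕ) + 1 ∈ topSet n k w ↔ (w.symm a : ℕ) < k := by
  simp only [topSet, Finset.mem_image, Finset.mem_filter, Finset.mem_univ, true_and]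
  constructor
  · rintro ⟨j, hj, h⟩
    have : w j = a := Fin.ext (by omega)
    simpa [← this] using hj
  · exact fun h => ⟨w.symm a, h, by simp⟩

theorem topSet_subset (n k : ℕ) (w : Equiv.Perm (Fin n)) : topSet n k w ⊆ Finset.Icc 1 n := by
  intro m hm
  simp only [topSet, Finset.mem_image] at hm
  obtain ⟨j, -, rfl⟩ := hm
  have := (w j).isLt
  simp only [Finset.mem_Icc]
  omega

/-- Subsets of `[n]` are determined by their 1-indexed members. -/
theorem ext_of_subset_Icc {n : ℕ} {A B : Finset ℕ} (hA : A ⊆ Finset.Icc 1 n)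
    (hB : B ⊆ Finset.Icc 1 n) (h : ∀ a : Fin n, (a : ℕ) + 1 ∈ A ↔ (a : ℕ) + 1 ∈ B) : A = B := by
  ext m
  by_cases hm : m ∈ Finset.Icc 1 n
  · rw [Finset.mem_Icc] at hm
    have := h ⟨m - 1, by omega⟩
    simpa [Nat.sub_add_cancel hm.1] using this
  · exact ⟨fun h => (hm (hA h)).elim, fun h => (hm (hB h)).elim⟩

theorem topSet_mul_swap_of_ne {n k : ℕ} (w : Equiv.Perm (Fin n)) {p q : Fin n}
    (hpq : (q : ℕ) = p + 1) (hq : (q : ℕ) ≠ k) :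
    topSet n k (w * Equiv.swap p q) = topSet n k w := by
  refine ext_of_subset_Icc (topSet_subset _ _ _) (topSet_subset _ _ _) fun a => ?_
  rw [mem_topSet, mem_topSet, symm_mul_swap_apply, Equiv.swap_apply_def]
  split_ifs with h1 h2
  · rw [h1]; omega
  · rw [h2]; omega
  · rfl

theorem sgen_eq_swap {n : ℕ} {p q : Fin n} (hpq : (q : ℕ) = p + 1) :
    sgen n q = Equiv.swap p q := by
  have hq := q.isLt
  rw [sgen, dif_pos ⟨by omega, hq⟩]
  congr 1
  exact Fin.ext (by simp only; omega)

open Finset in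
/-- The pairs `(a, b)` with `a < b` such that some set of `Q` contains `b` but not `a`. -/
def pathInversions (n : ℕ) (Q : List (Finset ℕ)) : Finset (Fin n × Fin n) :=
  open Classical in
  univ.filter fun p => p.1 < p.2 ∧ ∃ A ∈ Q, (p.2 : ℕ) + 1 ∈ A ∧ (p.1 : ℕ) + 1 ∉ A

theorem mem_pathInversions {n : ℕ} {Q : List (Finset ℕ)} {a b : Fin n} :
    (a, b) ∈ pathInversions n Q ↔ a < b ∧ ∃ A ∈ Q, (b : ℕ) + 1 ∈ A ∧ (a : ℕ) + 1 ∉ A := by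
  simp [pathInversions]

theorem pathInversions_trans {n : ℕ} {Q : List (Finset ℕ)}
    (hQ : ∀ A ∈ Q, ∀ B ∈ Q, WeaklySeparated A B) (a b c : Fin n)
    (hab : (a, b) ∈ pathInversions n Q) (hbc : (b, c) ∈ pathInversions n Q) :
    (a, c) ∈ pathInversions n Q := by
  rw [mem_pathInversions] at *
  obtain ⟨h1, A, hA, hbA, haA⟩ := hab
  obtain ⟨h2, B, hB, hcB, hbB⟩ := hbc
  refine ⟨h1.trans h2, ?_⟩
  by_cases hcA : (c : ℕ) + 1 ∈ A
  · exact ⟨A, hA, hcA, haA⟩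
  by_cases haB : (a : ℕ) + 1 ∈ B
  · rw [Fin.lt_def] at h1 h2
    rcases hQ A hA B hB with h | h
    · have := h _ (Finset.mem_sdiff.2 ⟨hbA, hbB⟩) _ (Finset.mem_sdiff.2 ⟨haB, haA⟩)
      omega
    · have := h _ (Finset.mem_sdiff.2 ⟨hcB, hcA⟩) _ (Finset.mem_sdiff.2 ⟨hbA, hbB⟩)
      omega
  · exact ⟨B, hB, hcB, haB⟩

theorem pathInversions_cotrans {n : ℕ} {Q : List (Finset ℕ)} (a b c : Fin n)
    (hab : a < b) (hbc : b < c) (hac : (a, c) ∈ pathInversions n Q) :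
    (a, b) ∈ pathInversions n Q ∨ (b, c) ∈ pathInversions n Q := by
  simp only [mem_pathInversions] at *
  obtain ⟨-, A, hA, hcA, haA⟩ := hac
  by_cases hbA : (b : ℕ) + 1 ∈ A
  · exact Or.inl ⟨hab, A, hA, hbA, haA⟩
  · exact Or.inr ⟨hbc, A, hA, hcA, hbA⟩

/-- Induction step: a word realizing the path `Q` up to `A`, whose inversions all come from
`Q ++ [B]`, extends to a word realizing `Q ++ [B]`. -/
theorem exists_extension {n k : ℕ} {Q : List (Finset ℕ)} {A B : Finset ℕ} {x y : ℕ}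
    (hsep : ∀ C ∈ Q ++ [B], ∀ D ∈ Q ++ [B], WeaklySeparated C D)
    (hA : A ⊆ Finset.Icc 1 n) (hB : B ⊆ Finset.Icc 1 n)
    (hy : y ∈ A) (hx : x ∉ A) (hyx : y < x) (hAB : B = insert x (A.erase y)) :
    ∀ (d : ℕ) (l : List ℕ),
      (pathInversions n (Q ++ [B]) \ inversions (l.map (sgen n)).prod).card = d →
      l.length = (inversions (l.map (sgen n)).prod).card →
      pathInversions n Q ⊆ inversions (l.map (sgen n)).prod →
      inversions (l.map (sgen n)).prod ⊆ pathInversions n (Q ++ [B]) →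
      (extractedPath n k l = Q ∧ topSet n k (l.map (sgen n)).prod = A ∨
        extractedPath n k l = Q ++ [B] ∧ topSet n k (l.map (sgen n)).prod = B) →
      ∃ l' : List ℕ, l'.length = (inversions (l'.map (sgen n)).prod).card ∧
        inversions (l'.map (sgen n)).prod = pathInversions n (Q ++ [B]) ∧
        extractedPath n k l' = Q ++ [B] ∧ topSet n k (l'.map (sgen n)).prod = B := by
  have hxB : x ∈ B := by simp [hAB]
  have hyB : y ∉ B := by simp [hAB, hyx.ne]
  intro d
  induction d with
  | zero =>
    intro l hd hlen _ hsub hcase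
    have heq : inversions (l.map (sgen n)).prod = pathInversions n (Q ++ [B]) :=
      hsub.antisymm (Finset.sdiff_eq_empty_iff_subset.1 (Finset.card_eq_zero.1 hd))
    refine ⟨l, hlen, heq, hcase.resolve_left ?_⟩
    rintro ⟨-, htop⟩
    have hx' := Finset.mem_Icc.1 (hB hxB)
    have hy' := Finset.mem_Icc.1 (hA hy)
    obtain ⟨u, hu⟩ : ∃ u : Fin n, (u : ℕ) + 1 = y := ⟨⟨y - 1, by omega⟩, by simp only; omega⟩
    obtain ⟨v, hv⟩ : ∃ v : Fin n, (v : ℕ) + 1 = x := ⟨⟨x - 1, by omega⟩, by simp only; omega⟩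
    have hmem : (u, v) ∈ pathInversions n (Q ++ [B]) :=
      mem_pathInversions.2 ⟨by rw [Fin.lt_def]; omega, B, by simp, hv ▸ hxB, hu ▸ hyB⟩
    rw [← heq, mem_inversions, Fin.lt_def, Fin.lt_def] at hmem
    rw [← htop, ← hu, mem_topSet] at hy
    rw [← htop, ← hv, mem_topSet] at hx
    omega
  | succ d ih =>
    intro l hd hlen hQ hsub hcase
    set w := (l.map (sgen n)).prod with hw
    have hne : inversions w ≠ pathInversions n (Q ++ [B]) := by
      intro h
      simp [h] at hd
    obtain ⟨p, q, hpq, hasc, hJ⟩ := exists_ascent_mem w _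
      (fun a b h => (mem_pathInversions.1 h).1) (pathInversions_trans hsep)
      pathInversions_cotrans hsub hne
    have hnot : (w p, w q) ∉ inversions w := by
      rw [mem_inversions, Fin.lt_def, Fin.lt_def]
      simp only [Equiv.symm_apply_apply]
      omega
    have hprod : ((l ++ [(q : ℕ)]).map (sgen n)).prod = w * Equiv.swap p q := by
      simp [hw, sgen_eq_swap hpq]
    have hinv := inversions_mul_swap w hpq hasc
    refine ih (l ++ [(q : ℕ)]) ?_ ?_ ?_ ?_ ?_
    · rw [hprod, hinv, Finset.sdiff_insert, Finset.card_erase_of_mem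
        (Finset.mem_sdiff.2 ⟨hJ, hnot⟩), hd, Nat.add_sub_cancel]
    · rw [hprod, hinv, Finset.card_insert_of_notMem hnot, ← hlen]
      simp
    · rw [hprod, hinv]
      exact hQ.trans (Finset.subset_insert _ _)
    · rw [hprod, hinv]
      exact Finset.insert_subset hJ hsub
    rw [hprod, extractedPath_append_singleton, ← hw, sgen_eq_swap hpq]
    by_cases hqk : (q : ℕ) = k
    · rw [if_pos hqk]
      have hnew : ((w q : Fin n) : ℕ) + 1 ∈ B ∧ ((w p : Fin n) : ℕ) + 1 ∉ B := by
        obtain ⟨h1, C, hC, h2⟩ := mem_pathInversions.1 hJ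
        rcases List.mem_append.1 hC with hC | hC
        · exact (hnot (hQ (mem_pathInversions.2 ⟨h1, C, hC, h2⟩))).elim
        · rwa [List.mem_singleton.1 hC] at h2
      have hp : ((w p : Fin n) : ℕ) + 1 ∈ topSet n k w := by
        rw [mem_topSet, Equiv.symm_apply_apply]; omega
      have hq : ((w q : Fin n) : ℕ) + 1 ∉ topSet n k w := by
        rw [mem_topSet, Equiv.symm_apply_apply]; omega
      rcases hcase with ⟨hex, htop⟩ | ⟨-, htop⟩
      · right
        rw [htop] at hp hq
        have hpy : ((w p : Fin n) : ℕ) + 1 = y := by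
          by_contra h
          exact hnew.2 (hAB ▸ Finset.mem_insert_of_mem (Finset.mem_erase.2 ⟨h, hp⟩))
        have hqx : ((w q : Fin n) : ℕ) + 1 = x := by
          have := hnew.1
          rw [hAB, Finset.mem_insert, Finset.mem_erase] at this
          exact this.resolve_right fun h => hq h.2
        have htop' : topSet n k (w * Equiv.swap p q) = B := by
          refine ext_of_subset_Icc (topSet_subset _ _ _) hB fun a => ?_
          obtain ⟨r, rfl⟩ := w.surjective a
          have hr : ((w r : Fin n) : ℕ) + 1 ∈ A ↔ (r : ℕ) < k := by
            rw [← htop, mem_topSet, Equiv.symm_apply_apply]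
          rw [mem_topSet, symm_mul_swap_apply, Equiv.symm_apply_apply, Equiv.swap_apply_def]
          split_ifs with h1 h2
          · subst h1
            simp only [hnew.2, iff_false]
            omega
          · subst h2
            simp only [hnew.1, iff_true]
            omega
          · have h1' : ((w r : Fin n) : ℕ) + 1 ≠ y := fun h =>
              h1 (w.injective (Fin.ext (by omega)))
            have h2' : ((w r : Fin n) : ℕ) + 1 ≠ x := fun h =>
              h2 (w.injective (Fin.ext (by omega)))
            rw [hAB, Finset.mem_insert, Finset.mem_erase, hr]
            simp [h1', h2']
        exact ⟨by rw [hex, htop'], htop'⟩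
      · rw [htop] at hq
        exact (hq hnew.1).elim
    · rw [if_neg hqk, List.append_nil, topSet_mul_swap_of_ne w hpq hqk]
      exact hcase

theorem topSet_one {n k : ℕ} (hk : k ≤ n) : topSet n k 1 = Finset.Icc 1 k := by
  refine ext_of_subset_Icc (topSet_subset _ _ _) (Finset.Icc_subset_Icc_right hk) fun a => ?_
  rw [mem_topSet, Finset.mem_Icc]
  change (a : ℕ) < k ↔ _
  omega

theorem pathInversions_singleton_Icc (n k : ℕ) : pathInversions n [Finset.Icc 1 k] = ∅ := by
  refine Finset.eq_empty_of_forall_notMem ?_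
  rintro ⟨a, b⟩ h
  obtain ⟨h1, A, hA, h2, h3⟩ := mem_pathInversions.1 h
  rw [List.mem_singleton.1 hA, Finset.mem_Icc] at h2 h3
  rw [Fin.lt_def] at h1
  omega

theorem exists_word_of_isMWSPath {n k : ℕ} (hk : k ≤ n) (P : List (Finset ℕ)) (hP : IsMWSPath P)
    (hhead : P.head? = some (Finset.Icc 1 k)) (hsub : ∀ A ∈ P, A ⊆ Finset.Icc 1 n) :
    ∃ l : List ℕ, l.length = (inversions (l.map (sgen n)).prod).card ∧
      inversions (l.map (sgen n)).prod = pathInversions n P ∧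
      extractedPath n k l = P ∧ P.getLast? = some (topSet n k (l.map (sgen n)).prod) := by
  induction P using List.reverseRecOn with
  | nil => simp at hhead
  | append_singleton Q B ih =>
    rcases List.eq_nil_or_concat Q with rfl | ⟨R, A, rfl⟩
    · obtain rfl : B = Finset.Icc 1 k := by simpa using hhead
      refine ⟨[], ?_⟩
      simp [inversions_one, pathInversions_singleton_Icc, extractedPath, kPrefixes, topSet_one hk]
    · rw [List.concat_eq_append] at *
      obtain ⟨hsep, hchain⟩ := hP
      have hchain' := List.isChain_append.1 hchain
      obtain ⟨x, y, hy, hx, hyx, hAB⟩ := hchain'.2.2 A (by simp) B (by simp)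
      obtain ⟨l, hlen, hinv, hex, htop⟩ := ih
        ⟨fun C hC D hD => hsep C (List.mem_append_left _ hC) D (List.mem_append_left _ hD),
          hchain'.1⟩
        (by simpa [List.head?_append] using hhead)
        (fun C hC => hsub C (List.mem_append_left _ hC))
      have htop' : topSet n k (l.map (sgen n)).prod = A := by simpa using htop.symm
      obtain ⟨l', h1, h2, h3, h4⟩ := exists_extension (k := k) hsep (hsub A (by simp))
        (hsub B (by simp)) hy hx hyx hAB _ l rfl hlen hinv.ge (by
          rw [hinv]
          rintro ⟨a, b⟩ hab
          obtain ⟨hlt, C, hC, h⟩ := mem_pathInversions.1 hab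
          exact mem_pathInversions.2 ⟨hlt, C, List.mem_append_left _ hC, h⟩)
        (Or.inl ⟨hex, htop'⟩)
      exact ⟨l', h1, h2, h3, by simp [h4]⟩

theorem stmt12 (n k : ℕ) (hk1 : 1 ≤ k) (hk2 : k ≤ n - 1)
    (P : List (Finset ℕ)) (hP : IsMWSPath P)
    (hhead : P.head? = some (Finset.Icc 1 k))
    (hsub : ∀ A ∈ P, A.card = k ∧ A ⊆ Finset.Icc 1 n) :
    ∃ (w : Equiv.Perm (Fin n)) (l : List ℕ),
      IsReducedWordFor n l w ∧ extractedPath n k l = P := by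
  obtain ⟨l, hlen, -, hex, -⟩ := exists_word_of_isMWSPath (hk2.trans (Nat.sub_le n 1)) P hP hhead
    fun A hA => (hsub A hA).2
  exact ⟨_, l, isReducedWordFor_of_length_eq hlen, hex⟩
end

section
/- If R = (A_0, ..., A_L) is a repeatable pattern with parameters (Δℓ, Δd) = (L, d) and |A_0| = k, then c_k >= L/d, where c_k = lim_{n→∞} M(k,n)/n (assumed to exist). -/
/-- The concatenation `(A_0, …, A_L, A_1+d, …, A_L+d, …, A_1+md, …, A_L+md)`. -/
def repConcat (P : List (Finset ℕ)) (d : ℕ) : ℕ → List (Finset ℕ)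
  | 0 => P
  | (m + 1) => repConcat P d m ++ P.tail.map (Finset.image (· + d * (m + 1)))

/-- `P = (A_0, …, A_L)` is a repeatable pattern with parameters `(L, d)`. -/
def IsRepeatablePattern (P : List (Finset ℕ)) (L d : ℕ) : Prop :=
  P.length = L + 1 ∧ IsMWSPath P ∧
    P.getLast? = P.head?.map (Finset.image (· + d)) ∧
    ∀ m : ℕ, IsMWSPath (repConcat P d m)

open Equiv in
/-- The inversions of a permutation, recorded as pairs of values. -/
def invs {n : ℕ} (u : Perm (Fin n)) : Finset (Fin n × Fin n) :=
  Finset.univ.filter fun p => p.1 < p.2 ∧ u.symm p.2 < u.symm p.1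

theorem mem_invs {n : ℕ} {u : Equiv.Perm (Fin n)} {a b : Fin n} :
    (a, b) ∈ invs u ↔ a < b ∧ u.symm b < u.symm a := by
  simp [invs]

theorem invs_mul_sgen_of_ascent {n i : ℕ} (u : Equiv.Perm (Fin n)) (h0 : 0 < i) (hn : i < n)
    (hu : u ⟨i - 1, by omega⟩ < u ⟨i, hn⟩) :
    invs (u * sgen n i) = insert (u ⟨i - 1, by omega⟩, u ⟨i, hn⟩) (invs u) := by
  ext ⟨a, b⟩
  obtain ⟨x, rfl⟩ := u.surjective a
  obtain ⟨y, rfl⟩ := u.surjective b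
  rw [Finset.mem_insert, mem_invs, mem_invs]
  have hs : ∀ z, (u * sgen n i).symm (u z) = Equiv.swap ⟨i - 1, by omega⟩ ⟨i, hn⟩ z := by
    intro z
    rw [Equiv.symm_apply_eq]
    simp [sgen, h0, hn]
  simp only [hs, Equiv.symm_apply_apply, Prod.mk.injEq, u.injective.eq_iff,
    Equiv.swap_apply_def]
  have hpq : (⟨i - 1, by omega⟩ : Fin n).val + 1 = (⟨i, hn⟩ : Fin n).val := by
    simp only
    omega
  generalize (⟨i - 1, by omega⟩ : Fin n) = p at *
  generalize (⟨i, hn⟩ : Fin n) = q at *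
  grind

theorem pair_notMem_invs_of_ascent {n i : ℕ} (u : Equiv.Perm (Fin n)) (hn : i < n) :
    (u ⟨i - 1, by omega⟩, u ⟨i, hn⟩) ∉ invs u := by
  simp [mem_invs]

theorem card_invs_mul_sgen_le {n : ℕ} (u : Equiv.Perm (Fin n)) (i : ℕ) :
    (invs (u * sgen n i)).card ≤ (invs u).card + 1 := by
  by_cases h : 0 < i ∧ i < n
  · rcases lt_trichotomy (u ⟨i - 1, by omega⟩) (u ⟨i, h.2⟩) with hu | hu | hu
    · rw [invs_mul_sgen_of_ascent u h.1 h.2 hu]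
      exact Finset.card_insert_le _ _
    · have := congrArg Fin.val (u.injective hu)
      simp at this
      omega
    · have key := invs_mul_sgen_of_ascent (u * sgen n i) h.1 h.2 (by simpa [sgen, h] using hu)
      rw [mul_assoc, sgen_mul_self, mul_one] at key
      rw [key]
      exact (Finset.card_le_card (Finset.subset_insert _ _)).trans (Nat.le_succ _)
  · simp [sgen, h]

theorem card_invs_prod_le {n : ℕ} (l : List ℕ) :
    (invs (l.map (sgen n)).prod).card ≤ l.length := by
  induction l using List.reverseRecOn with
  | nil =>
    have : invs (1 : Equiv.Perm (Fin n)) = ∅ := by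
      ext ⟨a, b⟩
      rw [mem_invs]
      exact iff_of_false (fun h => h.1.asymm h.2) (Finset.notMem_empty _)
    simp [this]
  | append_singleton l i ih =>
    have := card_invs_mul_sgen_le (l.map (sgen n)).prod i
    simp only [List.map_append, List.prod_append, List.map_cons, List.map_nil,
      List.prod_singleton, List.length_append, List.length_singleton]
    omega

/-- A biclosed set of pairs `a < b`: closed under composition, with closed complement. -/
structure IsBiclosed {n : ℕ} (T : Fin n → Fin n → Prop) : Prop where
  lt : ∀ {a b}, T a b → a < b
  trans : ∀ {a b c}, T a b → T b c → T a c
  cotrans : ∀ {a b c}, a < b → b < c → T a c → T a b ∨ T b c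

theorem IsBiclosed.order_trans {n : ℕ} {T : Fin n → Fin n → Prop} (hT : IsBiclosed T)
    {x y z : Fin n} (hxy : (x < y ∧ ¬ T x y) ∨ (y < x ∧ T y x))
    (hyz : (y < z ∧ ¬ T y z) ∨ (z < y ∧ T z y)) : (x < z ∧ ¬ T x z) ∨ (z < x ∧ T z x) := by
  rcases hxy with ⟨h1, h2⟩ | ⟨h1, h2⟩ <;> rcases hyz with ⟨h3, h4⟩ | ⟨h3, h4⟩
  · exact .inl ⟨h1.trans h3, fun h => (hT.cotrans h1 h3 h).elim h2 h4⟩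
  · rcases lt_trichotomy x z with h | rfl | h
    · exact .inl ⟨h, fun h' => h2 (hT.trans h' h4)⟩
    · exact (h2 h4).elim
    · exact .inr ⟨h, (hT.cotrans h h1 h4).resolve_right h2⟩
  · rcases lt_trichotomy x z with h | rfl | h
    · exact .inl ⟨h, fun h' => h4 (hT.trans h2 h')⟩
    · exact (h4 h2).elim
    · exact .inr ⟨h, (hT.cotrans h3 h h2).resolve_left h4⟩
  · exact .inr ⟨h3.trans h1, hT.trans h4 h2⟩

theorem rel_of_rel_succ {n : ℕ} (R : Fin n → Fin n → Prop)
    (htrans : ∀ x y z, R x y → R y z → R x z)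
    (h : ∀ i (_ : 0 < i) (hn : i < n), R ⟨i - 1, by omega⟩ ⟨i, hn⟩)
    {p q : Fin n} (hpq : p < q) : R p q := by
  obtain ⟨p, hp⟩ := p
  obtain ⟨q, hq⟩ := q
  simp only [Fin.mk_lt_mk] at hpq
  induction q, hpq using Nat.le_induction with
  | base => exact h (p + 1) (by omega) hq
  | succ q hle ih => exact htrans _ _ _ (ih (by omega)) (h (q + 1) (by omega) hq)

theorem IsBiclosed.exists_ascent {n : ℕ} {T : Fin n → Fin n → Prop} (hT : IsBiclosed T)
    (u : Equiv.Perm (Fin n)) (hsub : ∀ {a b}, (a, b) ∈ invs u → T a b)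
    (hne : ∃ a b, T a b ∧ (a, b) ∉ invs u) :
    ∃ i, ∃ (_ : 0 < i) (hn : i < n), u ⟨i - 1, by omega⟩ < u ⟨i, hn⟩ ∧
      T (u ⟨i - 1, by omega⟩) (u ⟨i, hn⟩) := by
  by_contra! hcon
  obtain ⟨a, b, hab, hnot⟩ := hne
  have key : ∀ p q, p < q → (u p < u q ∧ ¬ T (u p) (u q)) ∨ (u q < u p ∧ T (u q) (u p)) := by
    intro p q hpq
    refine rel_of_rel_succ
      (fun p q => (u p < u q ∧ ¬ T (u p) (u q)) ∨ (u q < u p ∧ T (u q) (u p)))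
      (fun _ _ _ => hT.order_trans) ?_ hpq
    intro i h0 hn
    rcases lt_trichotomy (u ⟨i - 1, by omega⟩) (u ⟨i, hn⟩) with hu | hu | hu
    · exact .inl ⟨hu, hcon i h0 hn hu⟩
    · have := congrArg Fin.val (u.injective hu)
      simp at this
      omega
    · refine .inr ⟨hu, hsub (mem_invs.2 ⟨hu, ?_⟩)⟩
      simp only [Equiv.symm_apply_apply, Fin.mk_lt_mk]
      omega
  have hlt := hT.lt hab
  rw [mem_invs, not_and, not_lt] at hnot
  have hpos : u.symm a < u.symm b :=
    lt_of_le_of_ne (hnot hlt) fun h => hlt.ne (u.symm.injective h)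
  have := key _ _ hpos
  simp only [Equiv.apply_symm_apply] at this
  exact this.elim (fun h => h.2 hab) (fun h => absurd h.1 hlt.asymm)

/-- Going up in the weak order from `u` until the inversion set is the biclosed set `T`. -/
theorem IsBiclosed.exists_word {n : ℕ} {T : Fin n → Fin n → Prop} (hT : IsBiclosed T)
    (u : Equiv.Perm (Fin n)) (hsub : ∀ {a b}, (a, b) ∈ invs u → T a b) :
    ∃ l : List ℕ, (∀ a b, (a, b) ∈ invs (u * (l.map (sgen n)).prod) ↔ T a b) ∧
      (invs u).card + l.length = (invs (u * (l.map (sgen n)).prod)).card := by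
  induction hm : (Finset.univ \ invs u).card using Nat.strong_induction_on generalizing u with
  | _ m ih =>
  by_cases hne : ∃ a b, T a b ∧ (a, b) ∉ invs u
  · obtain ⟨i, h0, hn, hu, hTu⟩ := hT.exists_ascent u hsub hne
    have hins := invs_mul_sgen_of_ascent u h0 hn hu
    have hnot := pair_notMem_invs_of_ascent u hn
    obtain ⟨l, hl, hlen⟩ := ih _ (by
        rw [← hm, hins]
        refine Finset.card_lt_card ((Finset.ssubset_iff_of_subset
          (Finset.sdiff_subset_sdiff le_rfl (Finset.subset_insert _ _))).2
          ⟨(u ⟨i - 1, by omega⟩, u ⟨i, hn⟩), ?_, ?_⟩)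
        · simpa using hnot
        · simp) (u * sgen n i) (by
        intro a b hab
        rw [hins, Finset.mem_insert, Prod.mk.injEq] at hab
        rcases hab with ⟨rfl, rfl⟩ | hab
        · exact hTu
        · exact hsub hab) rfl
    refine ⟨i :: l, by simpa [mul_assoc] using hl, ?_⟩
    rw [hins, Finset.card_insert_of_notMem hnot] at hlen
    simp only [List.length_cons, List.map_cons, List.prod_cons, ← mul_assoc]
    omega
  · push Not at hne
    exact ⟨[], fun a b => by simpa using ⟨hsub, hne a b⟩, by simp⟩

theorem mul_prod_map_sgen_first {n k : ℕ} (u : Equiv.Perm (Fin n)) (l : List ℕ)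
    (hl : l.count k = 0) (b : Fin n) :
    ((u * (l.map (sgen n)).prod).symm b : ℕ) < k ↔ (u.symm b : ℕ) < k := by
  induction l generalizing u with
  | nil => simp
  | cons i l ih =>
    rw [List.count_eq_zero, List.mem_cons, not_or, ← List.count_eq_zero] at hl
    rw [List.map_cons, List.prod_cons, ← mul_assoc, ih _ hl.2]
    by_cases h : 0 < i ∧ i < n
    · have : (u * sgen n i).symm b = Equiv.swap ⟨i - 1, by omega⟩ ⟨i, h.2⟩ (u.symm b) := by
        rw [Equiv.symm_apply_eq]
        simp [sgen, h]
      rw [this, Equiv.swap_apply_def]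
      have := hl.1
      split_ifs with h1 h2
      · rw [h1]
        simp only
        omega
      · rw [h2]
        simp only
        omega
      · rfl
    · simp [sgen, h]

/-- The pairs forced to be inverted when the sets `S 0, …, S i` all occur as initial segments. -/
def forced {n : ℕ} (S : ℕ → Finset (Fin n)) (i : ℕ) (a b : Fin n) : Prop :=
  a < b ∧ ∃ j ≤ i, b ∈ S j ∧ a ∉ S j

theorem isBiclosed_transGen_forced {n : ℕ} (S : ℕ → Finset (Fin n)) (i : ℕ) :
    IsBiclosed (Relation.TransGen (forced S i)) where
  lt h := by
    induction h with
    | single h => exact h.1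
    | tail _ h ih => exact ih.trans h.1
  trans := Relation.TransGen.trans
  cotrans := by
    intro a b c hab hbc h
    have split : ∀ {x y : Fin n}, x < b → b < y → forced S i x y →
        forced S i x b ∨ forced S i b y := by
      rintro x y hx hy ⟨-, j, hj, hyj, hxj⟩
      by_cases hb : b ∈ S j
      · exact .inl ⟨hx, j, hj, hb, hxj⟩
      · exact .inr ⟨hy, j, hj, hyj, hb⟩
    induction h with
    | single h => exact (split hab hbc h).imp .single .single
    | @tail x y hx hxy ih =>
      rcases lt_trichotomy b x with h | rfl | h
      · exact (ih h).imp id fun h' => h'.tail hxy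
      · exact .inl hx
      · exact (split h hbc hxy).imp hx.tail .single

theorem not_transGen_forced {n : ℕ} {S : ℕ → Finset (Fin n)} {i : ℕ}
    (hsep : ∀ j ≤ i, ∀ a ∈ S j \ S i, ∀ b ∈ S i \ S j, a < b) {a b : Fin n}
    (ha : a ∈ S i) (h : Relation.TransGen (forced S i) a b) : b ∈ S i := by
  have step : ∀ x y, x ∈ S i → forced S i x y → y ∈ S i := by
    rintro x y hx ⟨hxy, j, hj, hyj, hxj⟩
    by_contra hy
    exact (hsep j hj y (by simp [hyj, hy]) x (by simp [hx, hxj])).asymm hxy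
  induction h with
  | single h => exact step _ _ ha h
  | tail _ h ih => exact step _ _ ih h

theorem mem_iff_symm_lt_card {n : ℕ} (u : Equiv.Perm (Fin n)) (S : Finset (Fin n))
    (h : ∀ a ∈ S, ∀ b ∉ S, u.symm a < u.symm b) (b : Fin n) :
    b ∈ S ↔ (u.symm b : ℕ) < S.card := by
  have hcard : (S.map u.symm.toEmbedding).card = S.card := Finset.card_map _
  constructor
  · intro hb
    have : Finset.Iic (u.symm b) ⊆ S.map u.symm.toEmbedding := by
      intro q hq
      rw [Finset.mem_Iic] at hq
      simp only [Finset.mem_map_equiv, Equiv.symm_symm]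
      by_contra hqS
      have := h b hb _ hqS
      simp only [Equiv.symm_apply_apply] at this
      exact absurd hq this.not_ge
    have := Finset.card_le_card this
    rw [Fin.card_Iic] at this
    omega
  · intro hb
    by_contra hbS
    have : S.map u.symm.toEmbedding ⊆ Finset.Iio (u.symm b) := by
      intro q hq
      simp only [Finset.mem_map_equiv, Equiv.symm_symm] at hq
      simpa using h _ hq b hbS
    have := Finset.card_le_card this
    rw [Fin.card_Iio] at this
    omega

theorem mem_iff_of_invs_eq_forced {n : ℕ} {S : ℕ → Finset (Fin n)} {i : ℕ}
    (hsep : ∀ j ≤ i, ∀ a ∈ S j \ S i, ∀ b ∈ S i \ S j, a < b) {u : Equiv.Perm (Fin n)}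
    (hu : ∀ a b, (a, b) ∈ invs u ↔ Relation.TransGen (forced S i) a b) (b : Fin n) :
    b ∈ S i ↔ (u.symm b : ℕ) < (S i).card := by
  refine mem_iff_symm_lt_card u (S i) (fun a ha b hb => ?_) b
  rcases lt_trichotomy a b with hab | rfl | hab
  · by_contra hcon
    have hlt : u.symm b < u.symm a :=
      lt_of_le_of_ne (not_lt.1 hcon) fun h => hab.ne' (u.symm.injective h)
    exact hb (not_transGen_forced hsep ha ((hu a b).1 (mem_invs.2 ⟨hab, hlt⟩)))
  · exact (hb ha).elim
  · exact (mem_invs.1 ((hu b a).2 (.single ⟨hab, i, le_rfl, ha, hb⟩))).2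

theorem exists_word_forced {n k : ℕ} (S : ℕ → Finset (Fin n)) (N : ℕ)
    (hcard : ∀ i ≤ N, (S i).card = k)
    (hsep : ∀ i ≤ N, ∀ j ≤ i, ∀ a ∈ S j \ S i, ∀ b ∈ S i \ S j, a < b)
    (hne : ∀ i < N, S i ≠ S (i + 1)) :
    ∃ l : List ℕ,
      (∀ a b, (a, b) ∈ invs (l.map (sgen n)).prod ↔ Relation.TransGen (forced S N) a b) ∧
      l.length = (invs (l.map (sgen n)).prod).card ∧ N ≤ l.count k := by
  induction N with
  | zero =>
    have h1 : invs (1 : Equiv.Perm (Fin n)) = ∅ :=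
      Finset.card_eq_zero.1 (Nat.le_zero.1 (card_invs_prod_le []))
    obtain ⟨l, hl, hlen⟩ := (isBiclosed_transGen_forced S 0).exists_word 1 (by simp [h1])
    exact ⟨l, by simpa using hl, by simpa [h1] using hlen, Nat.zero_le _⟩
  | succ N ih =>
    obtain ⟨l, hl, hlen, hcount⟩ := ih (fun i hi => hcard i (by omega))
      (fun i hi => hsep i (by omega)) (fun i hi => hne i (by omega))
    obtain ⟨l', hl', hlen'⟩ := (isBiclosed_transGen_forced S (N + 1)).exists_word
      (l.map (sgen n)).prod (by
        intro a b hab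
        refine Relation.TransGen.mono ?_ a b ((hl a b).1 hab)
        rintro x y ⟨hxy, j, hj, h⟩
        exact ⟨hxy, j, by omega, h⟩)
    have hpos : l'.count k ≠ 0 := by
      intro h0
      refine hne N (by omega) (Finset.ext fun b => ?_)
      rw [mem_iff_of_invs_eq_forced (hsep N (by omega)) hl,
        mem_iff_of_invs_eq_forced (hsep (N + 1) le_rfl) hl', hcard N (by omega),
        hcard (N + 1) le_rfl, mul_prod_map_sgen_first _ _ h0]
    refine ⟨l ++ l', by simpa using hl', ?_, ?_⟩
    · rw [List.length_append, List.map_append, List.prod_append, ← hlen', hlen]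
    · rw [List.count_append]
      omega

theorem eq_longestPerm_of_invs {n : ℕ} {u : Equiv.Perm (Fin n)}
    (hu : ∀ a b, (a, b) ∈ invs u ↔ a < b) : u = longestPerm n := by
  have hanti : StrictAnti u.symm := fun a b hab => (mem_invs.1 ((hu a b).2 hab)).2
  have hmono : StrictMono (u.symm.trans Fin.revPerm) := fun a b hab => by
    simpa using hanti hab
  have hid : (u.symm.trans Fin.revPerm : Fin n → Fin n) = id := by
    have := Subsingleton.elim
      ((hmono.orderIsoOfSurjective _ (u.symm.trans Fin.revPerm).surjective)) (OrderIso.refl _)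
    funext x
    exact DFunLike.congr_fun this x
  ext x
  have := congrFun hid (u x)
  simp only [Equiv.coe_trans, Function.comp_apply, Equiv.symm_apply_apply, id] at this
  rw [← this]
  rfl

/-- A sequence of `k`-subsets increasing for strong separation bounds `Mmax k n` from below. -/
theorem le_Mmax_of_separated {n k : ℕ} (S : ℕ → Finset (Fin n)) (N : ℕ)
    (hcard : ∀ i ≤ N, (S i).card = k)
    (hsep : ∀ i ≤ N, ∀ j ≤ i, ∀ a ∈ S j \ S i, ∀ b ∈ S i \ S j, a < b)
    (hne : ∀ i < N, S i ≠ S (i + 1)) : N ≤ Mmax k n := by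
  obtain ⟨l, -, hlen, hcount⟩ := exists_word_forced S N hcard hsep hne
  have hlt : IsBiclosed (fun a b : Fin n => a < b) :=
    ⟨id, lt_trans, fun hab _ _ => .inl hab⟩
  obtain ⟨l', hl', hlen'⟩ :=
    hlt.exists_word (l.map (sgen n)).prod (fun hab => (mem_invs.1 hab).1)
  rw [← List.prod_append, ← List.map_append] at hl' hlen'
  have hw := eq_longestPerm_of_invs hl'
  have hred : IsReducedWordFor n (l ++ l') (longestPerm n) := by
    refine ⟨hw, fun m hm => ?_⟩
    have := card_invs_prod_le (n := n) m
    rw [hm, ← hw, ← hlen', ← hlen] at this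
    simpa using this
  refine hcount.trans (le_trans ?_ (le_csSup ⟨(l ++ l').length, ?_⟩ ⟨l ++ l', hred, rfl⟩))
  · simp [List.count_append]
  · rintro _ ⟨m, hm, rfl⟩
    exact List.count_le_length.trans (hm.2 _ hw)

theorem card_filter_le_of_step {A : Finset ℕ} {x y : ℕ} (hx : x ∉ A) (hyx : y < x)
    (t : ℕ) : (A.filter (t ≤ ·)).card ≤ ((insert x (A.erase y)).filter (t ≤ ·)).card := by
  refine Finset.card_le_card_of_injOn (fun z => if z = y then x else z) ?_ ?_
  · intro z hz
    simp only [Finset.coe_filter, Set.mem_ofPred_eq] at hz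
    by_cases h : z = y
    · simp [h]
      omega
    · simp [h, hz]
  · intro z hz w hw h
    simp only [Finset.coe_filter, Set.mem_ofPred_eq] at hz hw
    grind

theorem WeaklySeparated.lt_of_card_filter_le {I J : Finset ℕ} (h : WeaklySeparated I J)
    (hdom : ∀ t, (I.filter (t ≤ ·)).card ≤ (J.filter (t ≤ ·)).card) :
    ∀ a ∈ I \ J, ∀ b ∈ J \ I, a < b := by
  rcases h with h | h
  · exact h
  · intro a ha
    refine absurd (hdom a) (not_le.2 (Finset.card_lt_card ?_))
    rw [Finset.mem_sdiff] at ha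
    refine (Finset.ssubset_iff_of_subset fun b hb => ?_).2 ⟨a, by simp [ha.1], by simp [ha.2]⟩
    rw [Finset.mem_filter] at hb ⊢
    refine ⟨?_, hb.2⟩
    by_contra hbI
    have := h b (by simp [hb.1, hbI]) a (by simp [ha])
    omega

theorem length_le_Mmax_of_isMWSPath {n k N : ℕ} {Q : List (Finset ℕ)} (hQ : IsMWSPath Q)
    (hlen : Q.length = N + 1) (hcard : ∀ A ∈ Q, A.card = k)
    (hmem : ∀ A ∈ Q, ∀ x ∈ A, 0 < x ∧ x ≤ n) : N ≤ Mmax k n := by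
  obtain ⟨hws, hchain⟩ := hQ
  replace hchain := List.isChain_iff_getElem.1 hchain
  set A : ℕ → Finset ℕ := fun i => Q.getD i ∅ with hA
  have hAget : ∀ i (h : i < Q.length), A i = Q[i] := fun i h => by simp [hA, h]
  have hAmem : ∀ i ≤ N, A i ∈ Q := fun i hi => by
    rw [hAget i (by omega)]
    exact List.getElem_mem _
  have hstep : ∀ i < N, ∃ x y, y ∈ A i ∧ x ∉ A i ∧ y < x ∧
      A (i + 1) = insert x ((A i).erase y) := by
    intro i hi
    rw [hAget i (by omega), hAget (i + 1) (by omega)]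
    exact hchain i (by omega)
  have hdom : ∀ t j i, j ≤ i → i ≤ N →
      ((A j).filter (t ≤ ·)).card ≤ ((A i).filter (t ≤ ·)).card := by
    intro t j i hji
    induction i, hji using Nat.le_induction with
    | base => exact fun _ => le_rfl
    | succ i _ ih =>
      intro hi
      obtain ⟨x, y, -, hx, hyx, he⟩ := hstep i (by omega)
      rw [he]
      exact (ih (by omega)).trans (card_filter_le_of_step hx hyx t)
  let S : ℕ → Finset (Fin n) := fun i => Finset.univ.filter fun a => (a : ℕ) + 1 ∈ A i
  have hS : ∀ i (a : Fin n), a ∈ S i ↔ (a : ℕ) + 1 ∈ A i := fun i a => by simp [S]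
  have hlift : ∀ i ≤ N, ∀ x ∈ A i, ∃ a : Fin n, (a : ℕ) + 1 = x := by
    intro i hi x hx
    have := hmem _ (hAmem i hi) x hx
    exact ⟨⟨x - 1, by omega⟩, by simp only; omega⟩
  refine le_Mmax_of_separated S N ?_ ?_ ?_
  · intro i hi
    rw [← hcard _ (hAmem i hi)]
    refine Finset.card_bij (fun a _ => (a : ℕ) + 1) (fun a ha => (hS i a).1 ha) ?_ ?_
    · intro a _ b _ h
      exact Fin.ext (by simpa using h)
    · intro x hx
      obtain ⟨a, ha⟩ := hlift i hi x hx
      exact ⟨a, (hS i a).2 (ha ▸ hx), ha⟩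
  · intro i hi j hj a ha b hb
    rw [Finset.mem_sdiff, hS, hS] at ha hb
    have := (hws _ (hAmem j (by omega)) _ (hAmem i hi)).lt_of_card_filter_le
      (fun t => hdom t j i hj hi) _ (Finset.mem_sdiff.2 ha) _ (Finset.mem_sdiff.2 hb)
    rw [Fin.lt_def]
    omega
  · intro i hi heq
    obtain ⟨x, y, -, hx, -, he⟩ := hstep i hi
    have hx' : x ∈ A (i + 1) := by simp [he]
    obtain ⟨a, rfl⟩ := hlift (i + 1) (by omega) x hx'
    exact hx ((hS i a).1 (heq ▸ (hS (i + 1) a).2 hx'))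

theorem length_repConcat {P : List (Finset ℕ)} {L : ℕ} (hlen : P.length = L + 1) (d m : ℕ) :
    (repConcat P d m).length = L * (m + 1) + 1 := by
  induction m with
  | zero => simp [repConcat, hlen]
  | succ m ih =>
    simp only [repConcat, List.length_append, ih, List.length_map, List.length_tail, hlen]
    simp only [Nat.add_sub_cancel]
    ring

theorem exists_shift_of_mem_repConcat {P : List (Finset ℕ)} {d m : ℕ} {A : Finset ℕ}
    (hA : A ∈ repConcat P d m) : ∃ B ∈ P, ∃ s ≤ d * m, A = B.image (· + s) := by
  induction m with
  | zero => exact ⟨A, hA, 0, by simp, by simp⟩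
  | succ m ih =>
    rw [repConcat, List.mem_append, List.mem_map] at hA
    rcases hA with hA | ⟨B, hB, rfl⟩
    · obtain ⟨B, hB, s, hs, rfl⟩ := ih hA
      exact ⟨B, hB, s, hs.trans (by gcongr; omega), rfl⟩
    · exact ⟨B, List.mem_of_mem_tail hB, _, le_rfl, rfl⟩

theorem mul_le_Mmax_of_isRepeatablePattern {k L d : ℕ} {P : List (Finset ℕ)}
    (hP : IsRepeatablePattern P L d) (hcard : ∀ A ∈ P, A.card = k)
    (hpos : ∀ A ∈ P, ∀ x ∈ A, 0 < x) :
    ∃ b, ∀ m, L * (m + 1) ≤ Mmax k (d * m + b) := by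
  have hb : ∃ b, ∀ A ∈ P, ∀ x ∈ A, x ≤ b :=
    ⟨(P.toFinset.sup id).sup id, fun A hA x hx =>
      Finset.le_sup (f := id) (Finset.le_sup (f := id) (List.mem_toFinset.2 hA) hx)⟩
  obtain ⟨b, hb⟩ := hb
  refine ⟨b, fun m => length_le_Mmax_of_isMWSPath (hP.2.2.2 m) (length_repConcat hP.1 d m) ?_ ?_⟩
  · intro A hA
    obtain ⟨B, hB, s, -, rfl⟩ := exists_shift_of_mem_repConcat hA
    rw [Finset.card_image_of_injective _ (add_left_injective s), hcard B hB]
  · intro A hA x hx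
    obtain ⟨B, hB, s, hs, rfl⟩ := exists_shift_of_mem_repConcat hA
    obtain ⟨y, hy, rfl⟩ := Finset.mem_image.1 hx
    have := hpos B hB y hy
    have := hb B hB y hy
    omega

open Filter in
theorem stmt16 (k L d : ℕ) (hk : 0 < k) (hL : 0 < L) (hd : 0 < d)
    (P : List (Finset ℕ)) (hP : IsRepeatablePattern P L d)
    (hcard : ∀ A ∈ P, A.card = k) (hpos : ∀ A ∈ P, ∀ x ∈ A, 0 < x)
    (c : ℝ) (hc : Tendsto (fun n : ℕ => (Mmax k n : ℝ) / n) atTop (nhds c)) :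
    (L : ℝ) / d ≤ c := by
  obtain ⟨b, hb⟩ := mul_le_Mmax_of_isRepeatablePattern hP hcard hpos
  have hd' : (0 : ℝ) < d := by exact_mod_cast hd
  have hsub : Tendsto (fun m : ℕ => d * m + b) atTop atTop :=
    tendsto_atTop_mono (fun m => (Nat.le_mul_of_pos_left m hd).trans (Nat.le_add_right _ b))
      tendsto_id
  have hlim : Tendsto (fun m : ℕ => ((L : ℝ) * m + L) / ((d : ℝ) * m + b)) atTop
      (nhds ((L : ℝ) / d)) :=
    tendsto_add_mul_div_add_mul_atTop_nhds (𝕜 := ℝ) L b L hd'.ne' |>.congr fun m => by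
      rw [add_comm, add_comm (b : ℝ)]
  refine le_of_tendsto_of_tendsto' hlim (hc.comp hsub) fun m => ?_
  have := hb m
  simp only [Function.comp_apply]
  push_cast
  gcongr
  calc (L : ℝ) * m + L = ((L * (m + 1) : ℕ) : ℝ) := by push_cast; ring
    _ ≤ _ := by exact_mod_cast this
end
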